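/- Let n ≥ 4 and suppose λ ∈ Φ3^n satisfies both: (1) λ1² + λ1·λ2 + λ2² ≡ 3 (mod n), and (2) for every integer ℓ coprime to 3n, the inequality {ℓλ1}_n + {ℓλ2}_n < n holds if and only if 2·{ℓ}_n < n. Then: if n ≢ 0 (mod 4) and n ≠ 18, λ ∈ ⟨J⟩ρ; if n ≡ 0 (mod 4) and n ∉ {12,24,60}, λ ∈ ⟨J⟩ρ ∪ ⟨J⟩((n−2)/2,(n−2)/2); if n = 12, λ ∈ ⟨J⟩ρ ∪ ⟨J⟩(3,3) ∪ ⟨J⟩(5,5); if n = 18, λ ∈ ⟨J⟩ρ ∪ ⟨C,J⟩(4,1); if n = 24, λ ∈ ⟨J⟩ρ ∪ ⟨J⟩(5,5) ∪ ⟨J⟩(7,7) ∪ ⟨J⟩(11,11); if n = 60, λ ∈ ⟨J⟩ρ ∪ ⟨J⟩(11,11) ∪ ⟨J⟩(19,19) ∪ ⟨J⟩(29,29). -/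

import Mathlib

open scoped Classical
noncomputable section

/-- The set `Φ₃ⁿ` of SU(3) weights at height `n`. -/
def Phi3 (n : ℕ) : Finset (ℤ × ℤ) :=
  (Finset.Icc ((1 : ℤ), (1 : ℤ)) ((n : ℤ), (n : ℤ))).filter (fun l => l.1 + l.2 ≤ (n : ℤ) - 1)

/-- The order-3 simple current `Jλ = (n−λ₁−λ₂, λ₁)`. -/
def Jv (n : ℕ) (l : ℤ × ℤ) : ℤ × ℤ := ((n : ℤ) - l.1 - l.2, l.1)

/-- Conjugation `Cλ = (λ₂, λ₁)`. -/
def Cv (l : ℤ × ℤ) : ℤ × ℤ := (l.2, l.1)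

/-- The orbit `⟨J⟩λ = {λ, Jλ, J²λ}`. -/
def orbJ (n : ℕ) (l : ℤ × ℤ) : Finset (ℤ × ℤ) := {l, Jv n l, Jv n (Jv n l)}

/-- The orbit `⟨C,J⟩λ = {λ, Jλ, J²λ, Cλ, JCλ, J²Cλ}`. -/
def orbCJ (n : ℕ) (l : ℤ × ℤ) : Finset (ℤ × ℤ) := orbJ n l ∪ orbJ n (Cv l)


def hh (m x : ℤ) : ℤ := if 2 * (x % m) < m then 0 else 1

lemma hh_cases (m x : ℤ) : (hh m x = 0 ∧ 2 * (x % m) < m) ∨ (hh m x = 1 ∧ m ≤ 2 * (x % m)) := by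
  unfold hh; split_ifs with h
  · left; exact ⟨rfl, h⟩
  · right; exact ⟨rfl, by omega⟩

lemma emod_uniq {m x y : ℤ} (h0 : 0 ≤ y) (h1 : y < m) (h : m ∣ x - y) : x % m = y := by
  have h2 : x % m = y % m := (Int.emod_eq_emod_iff_emod_sub_eq_zero).2 (Int.emod_eq_zero_of_dvd h)
  rw [h2, Int.emod_eq_of_lt h0 h1]

lemma emod_rg {m : ℤ} (hm : 0 < m) (x : ℤ) : 0 ≤ x % m ∧ x % m < m ∧ m ∣ x - x % m :=
  ⟨Int.emod_nonneg _ hm.ne', Int.emod_lt_of_pos _ hm, Int.dvd_self_sub_emod⟩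

lemma emod_congr {m x y : ℤ} (h : m ∣ x - y) : x % m = y % m :=
  (Int.emod_eq_emod_iff_emod_sub_eq_zero).2 (Int.emod_eq_zero_of_dvd h)

lemma hh_congr {m x y : ℤ} (h : m ∣ x - y) : hh m x = hh m y := by
  unfold hh; rw [emod_congr h]

lemma dvd_of_emod_eq {m x y : ℤ} (h : x % m = y % m) : m ∣ x - y :=
  Int.dvd_of_emod_eq_zero ((Int.emod_eq_emod_iff_emod_sub_eq_zero).1 h)

lemma emod_dbl {m : ℤ} (hm : 0 < m) (x : ℤ) : (2 * x) % m = 2 * (x % m) - m * hh m x := by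
  obtain ⟨h0, h1, h2⟩ := emod_rg hm x
  rcases hh_cases m x with ⟨h, h'⟩ | ⟨h, h'⟩ <;> rw [h]
  · apply emod_uniq (by omega) (by omega)
    obtain ⟨k, hk⟩ := h2
    exact ⟨2 * k, by linarith⟩
  · apply emod_uniq (by omega) (by omega)
    obtain ⟨k, hk⟩ := h2
    exact ⟨2 * k + 1, by linarith⟩

lemma emod_ne_zero {m x : ℤ} (h : ¬ m ∣ x) : x % m ≠ 0 := fun h' => h (Int.dvd_of_emod_eq_zero h')

lemma emod_negg {m x : ℤ} (hm : 0 < m) (h : ¬ m ∣ x) : (-x) % m = m - x % m := by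
  obtain ⟨h0, h1, k, hk⟩ := emod_rg hm x
  have := emod_ne_zero h
  apply emod_uniq (by omega) (by omega)
  exact ⟨-k - 1, by linarith⟩

/-- exponential growth -/
lemma growth (X : ℕ → ℤ) (m B : ℤ) (h : ∀ i, 2 * X i - m ≤ X (i + 1)) (hB : ∀ i, X i ≤ B) :
    X 0 ≤ m := by
  have h1 : ∀ i : ℕ, 2 ^ i * (X 0 - m) ≤ X i - m := by
    intro i
    induction i with
    | zero => simp
    | succ k ih =>
      have := h k
      rw [pow_succ]
      nlinarith
  by_contra hc
  push Not at hc
  have h2 := h1 (B - m).toNat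
  have h3 := hB (B - m).toNat
  have h4 : ((B - m).toNat : ℤ) < 2 ^ (B - m).toNat := by
    exact_mod_cast Nat.lt_two_pow_self
  have h5 : (2 : ℤ) ^ (B - m).toNat ≤ 2 ^ (B - m).toNat * (X 0 - m) := by
    have : (0:ℤ) < 2 ^ (B - m).toNat := by positivity
    nlinarith
  have h6 := Int.self_le_toNat (B - m)
  linarith

lemma growth_zero (X : ℕ → ℤ) (B : ℤ) (h : ∀ i, X (i + 1) = 2 * X i) (hB : ∀ i, |X i| ≤ B) :
    X 0 = 0 := by
  have h1 := growth X 0 B (fun i => by rw [h i]; linarith) (fun i => le_trans (le_abs_self _) (hB i))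
  have h2 := growth (fun i => - X i) 0 B (fun i => by simp only [h i]; linarith)
    (fun i => le_trans (neg_le_abs _) (hB i))
  linarith

lemma two_pow_succ_mul (i : ℕ) (a : ℤ) : 2 ^ (i + 1) * a = 2 * (2 ^ i * a) := by ring

lemma hh_eq_all {m a b : ℤ} (hm : 0 < m) (h : ∀ i : ℕ, hh m (2 ^ i * a) = hh m (2 ^ i * b)) :
    a % m = b % m := by
  have := growth_zero (fun i => (2 ^ i * a) % m - (2 ^ i * b) % m) m ?_ ?_
  · simp at this; omega
  · intro i
    simp only [two_pow_succ_mul, emod_dbl hm, h i]; ring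
  · intro i
    have h1 := emod_rg hm (2 ^ i * a)
    have h2 := emod_rg hm (2 ^ i * b)
    rw [abs_le]; constructor <;> omega

lemma hh_ne_all {m a b : ℤ} (hm : 0 < m) (h : ∀ i : ℕ, hh m (2 ^ i * a) + hh m (2 ^ i * b) = 1) :
    a % m + b % m = m := by
  have := growth_zero (fun i => (2 ^ i * a) % m + (2 ^ i * b) % m - m) (2*m) ?_ ?_
  · simp at this; omega
  · intro i
    simp only [two_pow_succ_mul, emod_dbl hm]
    have : hh m (2 ^ i * a) = 1 - hh m (2 ^ i * b) := by linarith [h i]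
    rw [this]
    ring
  · intro i
    have h1 := emod_rg hm (2 ^ i * a)
    have h2 := emod_rg hm (2 ^ i * b)
    rw [abs_le]; constructor <;> omega

lemma hh_zero_all {m a : ℤ} (hm : 0 < m) (h : ∀ i : ℕ, hh m (2 ^ i * a) = 0) : m ∣ a := by
  have h1 := hh_eq_all (m := m) (a := a) (b := 0) hm (fun i => by rw [h i]; simp [hh, hm])
  exact Int.dvd_of_emod_eq_zero (by simpa using h1)

lemma hh_one_all {m a : ℤ} (hm : 0 < m) (h : ∀ i : ℕ, hh m (2 ^ i * a) = 1) : False := by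
  have h1 := hh_ne_all (m := m) (a := a) (b := 0) hm (fun i => by rw [h i]; simp [hh, hm])
  have := emod_rg hm a
  simp at h1; omega

lemma cop_two {m : ℤ} (h : m % 2 = 1) : IsCoprime (2 : ℤ) m := by
  have := Int.emod_add_mul_ediv m 2
  exact ⟨-(m / 2), 1, by linarith⟩

lemma cop_two_pow {m : ℤ} (h : m % 2 = 1) (i : ℕ) : IsCoprime (2 ^ i : ℤ) m := (cop_two h).pow_left

lemma cop_congr {m x y : ℤ} (h : m ∣ x - y) (hx : IsCoprime x m) : IsCoprime y m := by
  obtain ⟨k, hk⟩ := h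
  have : y = x + m * (-k) := by linarith
  rw [this]
  exact IsCoprime.add_mul_left_left hx _

lemma cop_not_dvd {n x p : ℤ} (h : IsCoprime x n) (hp : p ∣ n) (hp1 : 1 < p) : ¬ p ∣ x := by
  intro hx
  have := h.isUnit_of_dvd' hx hp
  rw [Int.isUnit_iff] at this
  omega

/-- coprimality through primes -/
lemma cop_of_primes {x n : ℤ} (_hn : n ≠ 0) (h : ∀ p : ℕ, p.Prime → (p : ℤ) ∣ n → ¬ (p : ℤ) ∣ x) : IsCoprime x n := by
  rw [Int.isCoprime_iff_gcd_eq_one]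
  by_contra hg
  obtain ⟨p, hp, hpg⟩ := Nat.exists_prime_and_dvd hg
  have h1 : (p : ℤ) ∣ (Int.gcd x n : ℤ) := by exact_mod_cast hpg
  exact h p hp (h1.trans (Int.gcd_dvd_right _ _)) (h1.trans (Int.gcd_dvd_left _ _))

lemma exists_prime_of_not_cop {x n : ℤ} (hc : ¬ IsCoprime x n) (hn : n ≠ 0): ∃ p : ℕ, p.Prime ∧ (p:ℤ) ∣ n ∧ (p:ℤ) ∣ x := by
  by_contra h
  push Not at h
  exact hc (cop_of_primes hn h)

structure Hyp (n a b c : ℤ) : Prop where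
  ha : 0 < a
  hb : 0 < b
  hc : 0 < c
  hsum : a + b + c = n
  T : n ∣ a * b + b * c + c * a + 3
  SS : ∀ ℓ, IsCoprime ℓ n → (ℓ * a) % n + (ℓ * b) % n + (ℓ * c) % n = n * (1 + hh n ℓ)

lemma Hyp.swap {n a b c : ℤ} (H : Hyp n a b c) : Hyp n b a c where
  ha := H.hb
  hb := H.ha
  hc := H.hc
  hsum := by linarith [H.hsum]
  T := by have := H.T; ring_nf at this ⊢; exact this
  SS := fun l hl => by have := H.SS l hl; linarith

lemma Hyp.rot {n a b c : ℤ} (H : Hyp n a b c) : Hyp n b c a where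
  ha := H.hb
  hb := H.hc
  hc := H.ha
  hsum := by linarith [H.hsum]
  T := by have := H.T; ring_nf at this ⊢; exact this
  SS := fun l hl => by have := H.SS l hl; linarith

lemma unit_not_dvd {n l a : ℤ} (hl : IsCoprime l n) (h : n ∣ l * a) : n ∣ a :=
  (hl.symm).dvd_of_dvd_mul_left h

lemma mk_hyp (n a b : ℤ) (ha : 0 < a) (hb : 0 < b) (hab : a + b < n)
    (hT : n ∣ a ^ 2 + a * b + b ^ 2 - 3)
    (hG : ∀ l : ℤ, Int.gcd l (3 * n) = 1 →
      ((l * a) % n + (l * b) % n < n ↔ 2 * (l % n) < n)) : Hyp n a b (n - a - b) where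
  ha := ha
  hb := hb
  hc := by linarith
  hsum := by ring
  T := by
    obtain ⟨k, hk⟩ := hT
    exact ⟨-k + a + b, by linear_combination -hk⟩
  SS := by
    have hn : 0 < n := by linarith
    have key : ∀ l : ℤ, IsCoprime l (3 * n) →
        (l * a) % n + (l * b) % n + (l * (n - a - b)) % n = n * (1 + hh n l) := by
      intro l hl
      have hl' : IsCoprime l n := hl.of_mul_right_right
      have hG' := hG l (Int.isCoprime_iff_gcd_eq_one.1 hl)
      obtain ⟨a0, a1, ka, hka⟩ := emod_rg hn (l * a)
      obtain ⟨b0, b1, kb, hkb⟩ := emod_rg hn (l * b)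
      obtain ⟨c0, c1, kc, hkc⟩ := emod_rg hn (l * (n - a - b))
      have nd : ∀ x : ℤ, 0 < x → x < n → (l * x) % n ≠ 0 := by
        intro x hx hx' h
        have := Int.le_of_dvd hx (unit_not_dvd hl' (Int.dvd_of_emod_eq_zero h))
        omega
      have na := nd a ha (by linarith)
      have nb := nd b hb (by linarith)
      have nc := nd (n - a - b) (by linarith) (by linarith)
      have hs : (l * a) % n + (l * b) % n + (l * (n - a - b)) % n = n * (l - ka - kb - kc) := by
        linear_combination -hka - hkb - hkc
      generalize (l * a) % n = A at *
      generalize (l * b) % n = B at *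
      generalize (l * (n - a - b)) % n = C at *
      rw [hs]
      have k0 : 0 < l - ka - kb - kc := by
        by_contra hh0; push Not at hh0
        have : 0 < A := by omega
        nlinarith
      have k3 : l - ka - kb - kc < 3 := by
        by_contra hh0; push Not at hh0; nlinarith
      generalize l - ka - kb - kc = K at *
      rcases hh_cases n l with ⟨h, h'⟩ | ⟨h, h'⟩
      · have h2 := hG'.2 h'
        rw [h]
        have : K = 1 := by
          have : K = 1 ∨ K = 2 := by omega
          rcases this with h | h
          · exact h
          · subst h; omega
        rw [this]; ring
      · have h2 : ¬ (A + B < n) := fun h3 => by have := hG'.1 h3; omega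
        rw [h]
        have : K = 2 := by
          have : K = 1 ∨ K = 2 := by omega
          rcases this with h | h
          · subst h; omega
          · exact h
        rw [this]; ring
    intro l hl
    by_cases h3 : IsCoprime l 3
    · exact key l (h3.mul_right hl)
    · have h3l : (3 : ℤ) ∣ l := by
        rcases (Int.prime_three.coprime_iff_not_dvd (n := l)).not.1 (fun h => h3 h.symm) |> not_not.1 with h
        exact h
      have h3n : ¬ (3 : ℤ) ∣ n := fun h => cop_not_dvd hl h (by norm_num) h3l
      have e1 : IsCoprime (l + n) 3 :=
        ((Int.prime_three.coprime_iff_not_dvd).2 (fun h => h3n ((Int.dvd_add_right h3l).1 h))).symm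
      have e2 : IsCoprime (l + n) n := cop_congr (x := l) ⟨-1, by ring⟩ hl
      have := key (l + n) (e1.mul_right e2)
      rw [hh_congr (m := n) (x := l + n) (y := l) ⟨1, by ring⟩,
        emod_congr (m := n) (x := (l + n) * a) (y := l * a) ⟨a, by ring⟩,
        emod_congr (m := n) (x := (l + n) * b) (y := l * b) ⟨b, by ring⟩,
        emod_congr (m := n) (x := (l + n) * (n - a - b)) (y := l * (n - a - b)) ⟨n - a - b, by ring⟩] at this
      exact this


def allB (k : ℕ) (f : ℕ → Bool) : Bool :=
  Nat.rec true (fun i ih => bif f i then ih else false) k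
def anyB (k : ℕ) (f : ℕ → Bool) : Bool :=
  Nat.rec false (fun i ih => bif f i then true else ih) k

lemma allB_spec {k : ℕ} {f : ℕ → Bool} (h : allB k f = true) : ∀ i < k, f i = true := by
  induction k with
  | zero => intro i hi; omega
  | succ k ih =>
    intro i hi
    change (bif f k then allB k f else false) = true at h
    rcases hf : f k with _ | _
    · rw [hf] at h; simp at h
    · rw [hf] at h
      rcases Nat.lt_succ_iff_lt_or_eq.1 hi with h1 | h1
      · exact ih (by simpa using h) i h1
      · rw [h1]; exact hf

lemma anyB_spec {k : ℕ} {f : ℕ → Bool} (h : anyB k f = true) : ∃ i < k, f i = true := by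
  induction k with
  | zero => simp [anyB] at h
  | succ k ih =>
    change (bif f k then true else anyB k f) = true at h
    rcases hf : f k with _ | _
    · rw [hf] at h
      obtain ⟨i, hi, h2⟩ := ih (by simpa using h)
      exact ⟨i, by omega, h2⟩
    · exact ⟨k, by omega, hf⟩

/-- `l` violates the parity rule -/
def viol (n a b c l : ℕ) : Bool :=
  (Nat.beq (Nat.gcd l n) 1) &&
    !(Nat.beq ((l * a) % n + (l * b) % n + (l * c) % n) (bif Nat.ble n (2 * l) then 2 * n else n))

def okS (n a b : ℕ) : Bool :=
  (Nat.beq a 1 && Nat.beq b 1) || (Nat.beq (n % 4) 0 && Nat.beq a 2 && Nat.beq (2 * b + 2) n) ||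
  (Nat.beq n 12 && Nat.beq a 3 && Nat.beq b 3) ||
  (Nat.beq n 18 && Nat.beq a 1 && Nat.beq b 4) ||
  (Nat.beq n 24 && Nat.beq a 5 && Nat.beq b 5) ||
  (Nat.beq n 24 && Nat.beq a 7 && Nat.beq b 7) ||
  (Nat.beq n 60 && Nat.beq a 11 && Nat.beq b 11) ||
  (Nat.beq n 60 && Nat.beq a 19 && Nat.beq b 19)

/-- check of the pair `(a+1, a+1+j)` -/
def brutePair (n a j : ℕ) : Bool :=
  bif Nat.beq (((a + 1) * (a + 1) + (a + 1) * (a + 1 + j) + (a + 1 + j) * (a + 1 + j)) % n) (3 % n) then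
    (bif okS n (a + 1) (a + 1 + j) then true else
      anyB n (viol n (a + 1) (a + 1 + j) (n - (a + 1) - (a + 1 + j))))
  else true

def brute (n : ℕ) : Bool :=
  allB (n / 3) (fun a => allB ((n - 3 * (a + 1)) / 2 + 1) (brutePair n a))

set_option maxRecDepth 100000 in
lemma brute_all : allB 79 (fun i => brute (2 * i + 4)) = true := by decide +kernel

def SmallC (n a b : ℤ) : Prop :=
  (a = 1 ∧ b = 1) ∨ (n % 4 = 0 ∧ a = 2 ∧ 2 * b + 2 = n) ∨ (n = 12 ∧ a = 3 ∧ b = 3) ∨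
  (n = 18 ∧ a = 1 ∧ b = 4) ∨ (n = 24 ∧ a = 5 ∧ b = 5) ∨ (n = 24 ∧ a = 7 ∧ b = 7) ∨
  (n = 60 ∧ a = 11 ∧ b = 11) ∨ (n = 60 ∧ a = 19 ∧ b = 19)

lemma viol_spec {n a b c l : ℕ} (hln : l < n) (H : Hyp n a b c) (h : viol n a b c l = true) : False := by
  simp only [viol, Bool.and_eq_true, Bool.not_eq_true', Nat.beq_eq] at h
  obtain ⟨h1, h2⟩ := h
  have h1' : Nat.gcd l n = 1 := by simpa using h1
  have hc : IsCoprime (l : ℤ) (n : ℤ) := Nat.isCoprime_iff_coprime.2 h1'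
  have h3 := H.SS l hc
  have hne : (l * a) % n + (l * b) % n + (l * c) % n ≠ (bif Nat.ble n (2 * l) then 2 * n else n) := by
    intro h; rw [h] at h2; simp at h2
  have hl : ((l : ℤ) % n) = l := Int.emod_eq_of_lt (by positivity) (by exact_mod_cast hln)
  apply hne
  unfold hh at h3
  rw [hl] at h3
  zify
  rw [h3]
  by_cases hle : n ≤ 2 * l
  · have : Nat.ble n (2 * l) = true := by rw [Nat.ble_eq]; exact hle
    rw [this, if_neg (by exact_mod_cast (by omega : ¬ 2 * l < n))]
    simp; ring
  · have : Nat.ble n (2 * l) = false := by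
      rw [Bool.eq_false_iff]; intro h; rw [Nat.ble_eq] at h; exact hle h
    rw [this, if_pos (by exact_mod_cast (by omega : 2 * l < n))]
    simp

lemma small_case {n a b c : ℤ} (H : Hyp n a b c) (hab : a ≤ b) (hbc : b ≤ c) (h4 : 4 ≤ n) (hn : n ≤ 160)
    (h2 : n % 2 = 0) : SmallC n a b := by
  have ha := H.ha
  have hb := H.hb
  have hc := H.hc
  have hsum := H.hsum
  obtain ⟨i, rfl⟩ : ∃ i : ℕ, n = ((2 * i + 4 : ℕ) : ℤ) := ⟨((n - 4) / 2).toNat, by omega⟩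
  obtain ⟨A, rfl⟩ : ∃ A : ℕ, a = ((A + 1 : ℕ) : ℤ) := ⟨(a - 1).toNat, by omega⟩
  obtain ⟨j, rfl⟩ : ∃ j : ℕ, b = ((A + 1 + j : ℕ) : ℤ) := ⟨(b - (A + 1 : ℕ)).toNat, by omega⟩
  obtain ⟨C, rfl⟩ : ∃ C : ℕ, c = (C : ℤ) := ⟨c.toNat, by omega⟩
  have h1 := allB_spec brute_all i (by omega)
  have h3 := allB_spec (allB_spec h1 A (by omega)) j (by omega)
  unfold brutePair at h3
  have hC : C = (2 * i + 4) - (A + 1) - (A + 1 + j) := by omega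
  have hT : Nat.beq (((A + 1) * (A + 1) + (A + 1) * (A + 1 + j) + (A + 1 + j) * (A + 1 + j)) % (2 * i + 4)) (3 % (2 * i + 4)) = true := by
    rw [Nat.beq_eq]
    zify
    apply emod_congr
    obtain ⟨k, hk⟩ := H.T
    have hC' : (C : ℤ) = 2 * i + 4 - (A + 1) - (A + 1 + j) := by omega
    rw [hC'] at hk
    push_cast at hk
    exact ⟨-k + (A + 1) + (A + 1 + j), by linear_combination -hk⟩
  rw [hT] at h3
  simp only [cond_true] at h3
  rcases ho : okS (2 * i + 4) (A + 1) (A + 1 + j) with _ | _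
  · exfalso
    rw [ho] at h3
    simp only [cond_false] at h3
    obtain ⟨l, hl, hv⟩ := anyB_spec h3
    rw [← hC] at hv
    exact viol_spec hl H hv
  · simp only [okS, Bool.or_eq_true, Bool.and_eq_true, Nat.beq_eq] at ho
    unfold SmallC
    rcases ho with ((((((h | h) | h) | h) | h) | h) | h) | h
    · left; omega
    · right; left; omega
    · right; right; left; omega
    · right; right; right; left; omega
    · right; right; right; right; left; omega
    · right; right; right; right; right; left; omega
    · right; right; right; right; right; right; left; omega
    · right; right; right; right; right; right; right; omega


lemma dvd_of_cop_mul {x n k : ℤ} (h : IsCoprime x n) (hk : n ∣ x * k) : n ∣ k := h.symm.dvd_of_dvd_mul_left hk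

lemma unit_of {p : ℕ} (hp : p.Prime) {n N w k : ℤ} (hn : n = p * N) (hn0 : n ≠ 0) (hw : IsCoprime w n)
    (hnd : ¬ (p : ℤ) ∣ w + k * N) : IsCoprime (w + k * N) n := by
  apply cop_of_primes hn0
  intro q hq hqn hqx
  have hq' : Prime (q : ℤ) := Nat.prime_iff_prime_int.1 hq
  rw [hn] at hqn
  rcases hq'.dvd_or_dvd hqn with h | h
  · have : q = p := (Nat.prime_dvd_prime_iff_eq hq hp).1 (by exact_mod_cast h)
    subst this
    exact hnd hqx
  · have h1 : (q : ℤ) ∣ w := (Int.dvd_add_left (Dvd.dvd.mul_left h k)).1 hqx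
    exact cop_not_dvd hw (by rw [hn]; exact Dvd.dvd.mul_left h _) (by exact_mod_cast hq.one_lt) h1

lemma unit_shift {p : ℕ} (hp : p.Prime) {n N w : ℤ} (hn : n = p * N) (hn0 : n ≠ 0) (hw : IsCoprime w n)
    (k1 k2 : ℤ) (h : 0 < k2 - k1) (h' : k2 - k1 < p) :
    IsCoprime (w + k1 * N) n ∨ IsCoprime (w + k2 * N) n := by
  have hp' : Prime (p : ℤ) := Nat.prime_iff_prime_int.1 hp
  by_cases h1 : (p : ℤ) ∣ w + k1 * N
  · by_cases h2 : (p : ℤ) ∣ w + k2 * N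
    · exfalso
      have h3 : (p : ℤ) ∣ (k2 - k1) * N := by
        have := Int.dvd_sub h2 h1
        convert this using 1; ring
      rcases hp'.dvd_or_dvd h3 with h4 | h4
      · have := Int.le_of_dvd h h4; omega
      · have h5 : (p : ℤ) ∣ w := (Int.dvd_add_left (Dvd.dvd.mul_left h4 k1)).1 h1
        exact cop_not_dvd hw (by rw [hn]; exact Dvd.intro _ rfl) (by exact_mod_cast hp.one_lt) h5
    · right; exact unit_of hp hn hn0 hw h2
  · left; exact unit_of hp hn hn0 hw h1

lemma hh_lo {m x : ℤ} (h0 : 0 ≤ x) (h : 2 * x < m) : hh m x = 0 := by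
  unfold hh; rw [Int.emod_eq_of_lt h0 (by omega), if_pos h]

lemma hh_hi {m x : ℤ} (h0 : m ≤ 2 * x) (h : x < m) : hh m x = 1 := by
  unfold hh; rw [Int.emod_eq_of_lt (by omega) h, if_neg (by omega)]

lemma three_contra {m N : ℤ} (hm : m = 3 * N) (hodd : m % 2 = 1) (h3 : ¬ (3 : ℤ) ∣ N) (h5 : 5 ≤ m)
    (h : ∀ u u', IsCoprime u m → IsCoprime u' m → N ∣ u - u' → hh m u = hh m u') : False := by
  have h1 : N % 3 = 1 ∨ N % 3 = 2 := by omega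
  have hm' : m = ((3 : ℕ) : ℤ) * N := by exact_mod_cast hm
  rcases h1 with h1 | h1
  · have e := h 2 (2 + 2 * N) (cop_two hodd)
      (unit_of Nat.prime_three hm' (by omega) (cop_two hodd) (by omega)) ⟨-2, by ring⟩
    rw [hh_lo (by norm_num) (by omega), hh_hi (by omega) (by omega)] at e
    omega
  · have e := h 1 (1 + 2 * N) isCoprime_one_left
      (unit_of Nat.prime_three hm' (by omega) isCoprime_one_left (by omega)) ⟨-2, by ring⟩
    rw [hh_lo (by norm_num) (by omega), hh_hi (by omega) (by omega)] at e
    omega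

lemma Hyp.odd_sum {n a b c : ℤ} (H : Hyp n a b c) (hodd : n % 2 = 1) (l : ℤ) (hl : IsCoprime l n) :
    hh n (l * a) + hh n (l * b) + hh n (l * c) = 1 + 2 * hh n l - hh n (2 * l) := by
  have hn : 0 < n := by linarith [H.ha, H.hb, H.hc, H.hsum]
  have h1 := H.SS l hl
  have h2 := H.SS (2 * l) ((cop_two hodd).mul_left hl)
  rw [mul_assoc, mul_assoc, mul_assoc, emod_dbl hn, emod_dbl hn, emod_dbl hn] at h2
  have : n * (hh n (l * a) + hh n (l * b) + hh n (l * c)) = n * (1 + 2 * hh n l - hh n (2 * l)) := by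
    linarith
  exact mul_left_cancel₀ hn.ne' this

lemma hh_bd (m x : ℤ) : 0 ≤ hh m x ∧ hh m x ≤ 1 := by
  rcases hh_cases m x with h | h <;> omega

lemma caseI_unit {n a b c : ℤ} (H : Hyp n a b c) (hodd : n % 2 = 1) (h5 : 5 ≤ n) : IsCoprime a n := by
  by_contra hcop
  obtain ⟨p, hp, hpn, hpa⟩ := exists_prime_of_not_cop hcop (by omega)
  have hp' : Prime (p : ℤ) := Nat.prime_iff_prime_int.1 hp
  have hsum := H.hsum
  have hT := H.T
  have hbc : (p : ℤ) ∣ b + c := by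
    have : b + c = n - a := by linarith
    rw [this]; exact Int.dvd_sub hpn hpa
  have hb3 : (p : ℤ) ∣ b ^ 2 - 3 := by
    have h1 := hpn.trans hT
    have : b ^ 2 - 3 = (b + c) * (a + b) - (a * b + b * c + c * a + 3) + a * 0 := by ring
    rw [this, mul_zero, add_zero]
    exact Int.dvd_sub (Dvd.dvd.mul_right hbc _) h1
  obtain ⟨N, hN⟩ := hpn
  have hN0 : 0 < N := by
    have : (0 : ℤ) < p := by exact_mod_cast hp.pos
    by_contra h; push Not at h; nlinarith
  have hpl : p = 2 ∨ p = 3 ∨ p = 5 ∨ p = 7 ∨ 11 ≤ p := by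
    by_contra hcon
    have : p < 11 := by omega
    interval_cases p <;> first | omega | (revert hp; decide)
  rcases hpl with rfl | rfl | rfl | rfl | hp11
  · push_cast at hN; omega
  · push_cast at *
    have hb : (3 : ℤ) ∣ b := by
      have : (3 : ℤ) ∣ b ^ 2 := by
        have := Int.dvd_add hb3 (dvd_refl 3); simpa using this
      exact hp'.dvd_of_dvd_pow (by exact_mod_cast this)
    have hc : (3 : ℤ) ∣ c := (Int.dvd_add_right hb).1 hbc
    obtain ⟨a', rfl⟩ := hpa
    obtain ⟨b', rfl⟩ := hb
    obtain ⟨c', rfl⟩ := hc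
    refine three_contra hN hodd ?_ h5 ?_
    · rintro ⟨k, hk⟩
      obtain ⟨t, ht⟩ := hT
      rw [hN, hk] at ht
      have : 9 * (a' * b' + b' * c' + c' * a' - k * t) = -3 := by linear_combination ht
      omega
    · intro u u' hu hu' hd
      have h1 := H.SS u hu
      have h2 := H.SS u' hu'
      obtain ⟨k, hk⟩ := hd
      have hx : ∀ x, (u * (3 * x)) % n = (u' * (3 * x)) % n := fun x =>
        emod_congr ⟨k * x, by rw [hN]; linear_combination 3 * x * hk⟩
      rw [hx, hx, hx, h2] at h1
      have := mul_left_cancel₀ (by omega) h1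
      linarith
  · push_cast at *
    have : b % 5 = 0 ∨ b % 5 = 1 ∨ b % 5 = 2 ∨ b % 5 = 3 ∨ b % 5 = 4 := by omega
    have h2 := Int.emod_eq_zero_of_dvd hb3
    rcases this with h | h | h | h | h <;> simp [pow_two, Int.sub_emod, Int.mul_emod, h] at h2
  · push_cast at *
    have : b % 7 = 0 ∨ b % 7 = 1 ∨ b % 7 = 2 ∨ b % 7 = 3 ∨ b % 7 = 4 ∨ b % 7 = 5 ∨ b % 7 = 6 := by omega
    have h2 := Int.emod_eq_zero_of_dvd hb3
    rcases this with h | h | h | h | h | h | h <;> simp [pow_two, Int.sub_emod, Int.mul_emod, h] at h2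
  · have hp11' : (11 : ℤ) ≤ p := by exact_mod_cast hp11
    have hpo : (p : ℤ) % 2 = 1 := by
      have := hp.eq_two_or_odd; omega
    have lo : ∀ k : ℤ, p + 1 ≤ 4 * k → 2 * k ≤ p - 3 → IsCoprime (1 + k * N) n → hh n ((1 + k * N) * a) = 0 := by
      intro k h1 h2 hu
      have b1 : n < 4 * (1 + k * N) := by rw [hN]; nlinarith
      have b2 : 2 * (1 + k * N) < n := by rw [hN]; nlinarith
      have hs := H.odd_sum hodd _ hu
      rw [hh_lo (x := 1 + k * N) (by omega) b2, hh_hi (x := 2 * (1 + k * N)) (by omega) (by omega)] at hs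
      have := hh_bd n ((1 + k * N) * a)
      have := hh_bd n ((1 + k * N) * b)
      have := hh_bd n ((1 + k * N) * c)
      omega
    have hi : ∀ k : ℤ, p + 1 ≤ 2 * k → 4 * k ≤ 3 * p - 5 → IsCoprime (1 + k * N) n → hh n ((1 + k * N) * a) = 1 := by
      intro k h1 h2 hu
      have b1 : n < 2 * (1 + k * N) := by rw [hN]; nlinarith
      have b2 : 4 * (1 + k * N) < 3 * n := by rw [hN]; nlinarith
      have hs := H.odd_sum hodd _ hu
      have e : hh n (2 * (1 + k * N)) = 0 := by
        rw [hh_congr (y := 2 * (1 + k * N) - n) ⟨1, by ring⟩]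
        exact hh_lo (by omega) (by omega)
      rw [e, hh_hi (x := 1 + k * N) (by omega) (by omega)] at hs
      have := hh_bd n ((1 + k * N) * a)
      have := hh_bd n ((1 + k * N) * b)
      have := hh_bd n ((1 + k * N) * c)
      omega
    have e1 : ∃ k, hh n ((1 + k * N) * a) = 0 := by
      rcases unit_shift hp hN (by omega) isCoprime_one_left ((p : ℤ) / 4 + 1) ((p : ℤ) / 4 + 2) (by omega) (by omega) with h | h
      · exact ⟨_, lo _ (by omega) (by omega) h⟩
      · exact ⟨_, lo _ (by omega) (by omega) h⟩
    have e2 : ∃ k, hh n ((1 + k * N) * a) = 1 := by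
      rcases unit_shift hp hN (by omega) isCoprime_one_left (((p : ℤ) + 1) / 2) (((p : ℤ) + 1) / 2 + 1) (by omega) (by omega) with h | h
      · exact ⟨_, hi _ (by omega) (by omega) h⟩
      · exact ⟨_, hi _ (by omega) (by omega) h⟩
    obtain ⟨k1, e1⟩ := e1
    obtain ⟨k2, e2⟩ := e2
    obtain ⟨a', ha'⟩ := hpa
    rw [hh_congr (m := n) (y := (1 + k2 * N) * a) ⟨(k1 - k2) * a', by rw [hN, ha']; ring⟩] at e1
    omega

lemma caseI_core {n x y z : ℤ} (H : Hyp n x y z) (hodd : n % 2 = 1) (h5 : 5 ≤ n)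
    (hx : hh n x = 0) (hy : hh n y = 0) (hz : hh n z = 1) : x = 1 ∧ y = 1 := by
  have hn : 0 < n := by omega
  have ux := caseI_unit H hodd h5
  have uy := caseI_unit H.swap hodd h5
  have uz := caseI_unit H.rot.rot hodd h5
  obtain ⟨t, ht⟩ := H.T
  have hsum := H.hsum
  have sx := H.SS x ux
  have sy := H.SS y uy
  have sz := H.SS z uz
  rw [hx] at sx
  rw [hy] at sy
  rw [hz] at sz
  obtain ⟨X0, X1, kX, hX⟩ := emod_rg hn (x * x)
  obtain ⟨Y0, Y1, kY, hY⟩ := emod_rg hn (y * y)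
  obtain ⟨Z0, Z1, kZ, hZ⟩ := emod_rg hn (z * z)
  have f : ∀ w X k: ℤ, 0 ≤ X → X < n → (∃ k, w - (X - 3) = n * k) → (w % n = X - 3 ∧ 3 ≤ X) ∨ (w % n = X - 3 + n ∧ X < 3) := by
    intro w X k h0 h1 ⟨k, hk⟩
    by_cases h : 3 ≤ X
    · left; exact ⟨emod_uniq (by omega) (by omega) ⟨k, hk⟩, h⟩
    · right; exact ⟨emod_uniq (by omega) (by omega) ⟨k - 1, by linarith⟩, by omega⟩
  have fxy := f (x * y) (z * z % n) 0 Z0 Z1 ⟨kZ + t - z, by linear_combination ht - z * hsum + hZ⟩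
  have fyz := f (y * z) (x * x % n) 0 X0 X1 ⟨kX + t - x, by linear_combination ht - x * hsum + hX⟩
  have fxz := f (x * z) (y * y % n) 0 Y0 Y1 ⟨kY + t - y, by linear_combination ht - y * hsum + hY⟩
  rw [mul_comm y x] at sy
  rw [mul_comm z x, mul_comm z y] at sz
  have hXne : x * x % n ≠ 0 := by
    intro h
    have := cop_not_dvd (ux.mul_left ux) (dvd_refl n) (by omega)
    exact this (Int.dvd_of_emod_eq_zero h)
  have hYne : y * y % n ≠ 0 := by
    intro h
    have := cop_not_dvd (uy.mul_left uy) (dvd_refl n) (by omega)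
    exact this (Int.dvd_of_emod_eq_zero h)
  have hxy : x * y % n ≠ 0 := by
    intro h
    have := cop_not_dvd (ux.mul_left uy) (dvd_refl n) (by omega)
    exact this (Int.dvd_of_emod_eq_zero h)
  have hres : x * x % n = 1 ∧ y * y % n = 1 ∧ x * y % n = 1 := by
    generalize x * x % n = X at *
    generalize y * y % n = Y at *
    generalize z * z % n = Z at *
    generalize x * y % n = P at *
    generalize y * z % n = Q at *
    generalize x * z % n = R at *
    clear hX hY hZ ht f
    omega
  have hxy' : n ∣ x * (x - y) := by
    have := dvd_of_emod_eq (hres.1.trans hres.2.2.symm)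
    rwa [← mul_sub] at this
  have hd := dvd_of_cop_mul ux hxy'
  have hx0 := H.ha
  have hy0 := H.hb
  have hz0 := H.hc
  have hxy2 : x = y := by
    have h1 := emod_congr hd
    rwa [Int.emod_eq_of_lt (by omega) (by omega), Int.emod_eq_of_lt (by omega) (by omega)] at h1
  subst hxy2
  have hx1 : x % n = 1 % n := by
    apply hh_eq_all hn
    intro i
    have u := cop_two_pow hodd i
    have h1 := H.SS _ u
    have nd : ¬ n ∣ 2 * (2 ^ i * x) := cop_not_dvd ((cop_two hodd).mul_left (u.mul_left ux)) (dvd_refl n) (by omega)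
    have e : (2 ^ i * z) % n = n - (2 * (2 ^ i * x) % n) := by
      rw [← emod_negg hn nd]
      exact emod_congr ⟨2 ^ i, by linear_combination 2 ^ i * hsum⟩
    rw [e, emod_dbl hn] at h1
    rw [mul_one]
    have h2 : n * hh n (2 ^ i * x) = n * hh n (2 ^ i) := by linarith
    exact mul_left_cancel₀ hn.ne' h2
  rw [Int.emod_eq_of_lt (by omega) (by omega), Int.emod_eq_of_lt (by omega) (by omega)] at hx1
  exact ⟨hx1, hx1⟩

/-- desired conclusion for large `n` -/
def Concl (n a b c : ℤ) : Prop :=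
  (a = 1 ∧ b = 1) ∨ (b = 1 ∧ c = 1) ∨ (c = 1 ∧ a = 1) ∨
  (n % 4 = 0 ∧ ((2 * a = n - 2 ∧ 2 * b = n - 2) ∨ (2 * b = n - 2 ∧ 2 * c = n - 2) ∨ (2 * c = n - 2 ∧ 2 * a = n - 2)))

lemma Concl.rot {n a b c : ℤ} (h : Concl n a b c) : Concl n b c a := by
  unfold Concl at *; tauto

lemma caseI {n a b c : ℤ} (H : Hyp n a b c) (hodd : n % 2 = 1) (h5 : 5 ≤ n) : Concl n a b c := by
  have h1 := H.odd_sum hodd 1 isCoprime_one_left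
  rw [one_mul, one_mul, one_mul, hh_lo (x := 1) (by norm_num) (by omega), hh_lo (x := 2 * 1) (by norm_num) (by omega)] at h1
  have ba := hh_bd n a
  have bb := hh_bd n b
  have bc := hh_bd n c
  by_cases hc : hh n c = 1
  · left; exact caseI_core H hodd h5 (by omega) (by omega) hc
  by_cases ha : hh n a = 1
  · right; left; exact caseI_core H.rot hodd h5 (by omega) (by omega) ha
  · right; right; left; exact caseI_core H.rot.rot hodd h5 (by omega) (by omega) (by omega)


def RR (L x y w : ℤ) : Prop :=
  ∀ l, IsCoprime l L → (l * x) % L + (l * y) % L + 2 * ((l * w) % L) = 2 * L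

lemma shift_sum {L : ℤ} (hL : 0 < L) (w : ℤ) : w % (2 * L) + (w + L) % (2 * L) = 2 * (w % L) + L := by
  obtain ⟨h0, h1, k, hk⟩ := emod_rg hL w
  obtain ⟨j, hj | hj⟩ : ∃ j, k = 2 * j ∨ k = 2 * j + 1 := ⟨k / 2, by omega⟩
  · rw [emod_uniq (x := w) (m := 2 * L) (y := w % L) h0 (by omega) ⟨j, by rw [hk, hj]; ring⟩,
      emod_uniq (x := w + L) (m := 2 * L) (y := w % L + L) (by omega) (by omega) ⟨j, by rw [hj] at hk; linear_combination hk⟩]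
    ring
  · rw [emod_uniq (x := w) (m := 2 * L) (y := w % L + L) (by omega) (by omega) ⟨j, by rw [hj] at hk; linear_combination hk⟩,
      emod_uniq (m := 2 * L) (y := w % L) h0 (by omega) ⟨j + 1, by rw [hj] at hk; linear_combination hk⟩]
    ring

lemma shift_sum' {L : ℤ} (hL : 0 < L) (l x : ℤ) (hx : x % 2 = 1) :
    (l * x) % (2 * L) + ((l + L) * x) % (2 * L) = 2 * ((l * x) % L) + L := by
  rw [← shift_sum hL]
  congr 1
  exact emod_congr ⟨x / 2, by
    have := Int.emod_add_mul_ediv x 2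
    rw [hx] at this
    linear_combination L * (-this)⟩

lemma emod_two_mul {L : ℤ} (_hL : 0 < L) (w : ℤ) : (2 * w) % (2 * L) = 2 * (w % L) := by
  rw [Int.mul_emod_mul_of_pos _ _ (by norm_num)]

lemma cop_two_mul {l L : ℤ} (h : IsCoprime l L) (hL : L % 2 = 0) : IsCoprime l (2 * L) := by
  have : (2 : ℤ) ∣ L := Int.dvd_of_emod_eq_zero hL
  exact (h.of_isCoprime_of_dvd_right this).mul_right h

lemma cop_odd {l L : ℤ} (h : IsCoprime l L) (hL : L % 2 = 0) : l % 2 = 1 := by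
  have := cop_not_dvd h (p := 2) (Int.dvd_of_emod_eq_zero hL) (by norm_num)
  omega

lemma hh_half {L : ℤ} (hL : 0 < L) (w : ℤ) : hh (2 * L) (w + L) = 1 - hh (2 * L) w := by
  have h := shift_sum hL w
  have := emod_rg hL w
  have := emod_rg (m := 2 * L) (by omega) w
  have := emod_rg (m := 2 * L) (by omega) (w + L)
  have h3 : w % (2 * L) % L = w % L := Int.emod_emod_of_dvd _ ⟨2, by ring⟩
  rcases hh_cases (2 * L) w with ⟨e, e'⟩ | ⟨e, e'⟩
  · rw [Int.emod_eq_of_lt (by omega) (by omega)] at h3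
    rcases hh_cases (2 * L) (w + L) with f | f <;> omega
  · have : w % (2 * L) = w % L + L := by
      have h4 : (w % (2 * L) - L) % L = w % L := by rw [← h3]; exact emod_congr ⟨-1, by ring⟩
      rw [Int.emod_eq_of_lt (by omega) (by omega)] at h4
      omega
    rcases hh_cases (2 * L) (w + L) with f | f <;> omega

lemma RR_top {M x y w : ℤ} (hM : M % 2 = 0) (hx : x % 2 = 1) (hy : y % 2 = 1)
    (H : Hyp (2 * M) x y (2 * w)) : RR M x y w := by
  intro l hl
  have hM0 : 0 < M := by linarith [H.ha, H.hb, H.hc, H.hsum]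
  have hl2 : IsCoprime (l + M) M := cop_congr (x := l) ⟨-1, by ring⟩ hl
  have s1 := H.SS l (cop_two_mul hl hM)
  have s2 := H.SS (l + M) (cop_two_mul hl2 hM)
  rw [hh_half hM0] at s2
  have e1 := shift_sum' hM0 l x hx
  have e2 := shift_sum' hM0 l y hy
  have e3 : (l * (2 * w)) % (2 * M) = 2 * ((l * w) % M) := by
    rw [← emod_two_mul hM0]; congr 1; ring
  have e4 : ((l + M) * (2 * w)) % (2 * M) = 2 * ((l * w) % M) := by
    rw [← e3]; exact emod_congr ⟨w, by ring⟩
  rw [e3] at s1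
  rw [e4] at s2
  linarith

lemma RR_desc {L x y w : ℤ} (hL0 : 0 < L) (hL : L % 2 = 0) (hx : x % 2 = 1) (hy : y % 2 = 1) (hw : w % 2 = 1)
    (h : RR (2 * L) x y w) : RR L x y w := by
  intro l hl
  have hl2 : IsCoprime (l + L) L := cop_congr (x := l) ⟨-1, by ring⟩ hl
  have s1 := h l (cop_two_mul hl hL)
  have s2 := h (l + L) (cop_two_mul hl2 hL)
  have e1 := shift_sum' hL0 l x hx
  have e2 := shift_sum' hL0 l y hy
  have e3 := shift_sum' hL0 l w hw
  linarith

/-- base evaluation -/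
lemma emod_two_add {m : ℤ} (hm : 0 < m) (w : ℤ) :
    (2 * w + m) % (2 * m) = 2 * (w % m) + m * (1 - 2 * hh m w) := by
  obtain ⟨h0, h1, k, hk⟩ := emod_rg hm w
  rcases hh_cases m w with ⟨h, h'⟩ | ⟨h, h'⟩ <;> rw [h]
  · exact emod_uniq (by omega) (by omega) ⟨k, by linear_combination 2 * hk⟩
  · exact emod_uniq (by omega) (by omega) ⟨k + 1, by linear_combination 2 * hk⟩

lemma emod_two_add' {m : ℤ} (hm : 0 < m) (u x : ℤ) (hx : x % 2 = 1) :
    ((2 * u + m) * x) % (2 * m) = 2 * ((u * x) % m) + m * (1 - 2 * hh m (u * x)) := by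
  rw [← emod_two_add hm]
  exact emod_congr ⟨x / 2, by
    have := Int.emod_add_mul_ediv x 2
    rw [hx] at this
    linear_combination m * (-this)⟩

lemma cop_base {m u : ℤ} (hodd : m % 2 = 1) (hu : IsCoprime u m) : IsCoprime (2 * u + m) (2 * m) := by
  apply IsCoprime.mul_right
  · exact cop_congr (m := 2) (x := m) ⟨-u, by ring⟩ (cop_two hodd).symm
  · exact cop_congr (m := m) (x := 2 * u) ⟨-1, by ring⟩ ((cop_two hodd).mul_left hu)

lemma RR_base {m x y w : ℤ} (hm : 0 < m) (hodd : m % 2 = 1) (hx : x % 2 = 1) (hy : y % 2 = 1) (hw : w % 2 = 1)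
    (h : RR (2 * m) x y w) : (m ∣ x - y ∧ m ∣ x + w) ∨ (m ∣ w ∧ m ∣ x + y) := by
  have hQ : ∀ u, IsCoprime u m → (u * x) % m + (u * y) % m + 2 * ((u * w) % m) =
      m * (hh m (u * x) + hh m (u * y) + 2 * hh m (u * w)) := by
    intro u hu
    have := h _ (cop_base hodd hu)
    rw [emod_two_add' hm _ _ hx, emod_two_add' hm _ _ hy, emod_two_add' hm _ _ hw] at this
    linarith
  have hq : ∀ i : ℕ, hh m (2 ^ i * x) + hh m (2 ^ i * y) + 2 * hh m (2 ^ i * w) = hh m x + hh m y + 2 * hh m w := by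
    intro i
    induction i with
    | zero => simp
    | succ i ih =>
      rw [← ih]
      have h1 := hQ _ (cop_two_pow hodd i)
      have h2 := hQ _ (cop_two_pow hodd (i + 1))
      simp only [two_pow_succ_mul] at h2 ⊢
      rw [emod_dbl hm, emod_dbl hm, emod_dbl hm] at h2
      have : m * (hh m (2 * (2 ^ i * x)) + hh m (2 * (2 ^ i * y)) + 2 * hh m (2 * (2 ^ i * w))) =
        m * (hh m (2 ^ i * x) + hh m (2 ^ i * y) + 2 * hh m (2 ^ i * w)) := by linarith
      exact mul_left_cancel₀ hm.ne' this
  have bd := fun (i : ℕ) => And.intro (hh_bd m (2 ^ i * x)) (And.intro (hh_bd m (2 ^ i * y)) (hh_bd m (2 ^ i * w)))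
  have hc : ∃ q, hh m x + hh m y + 2 * hh m w = q ∧ (q = 0 ∨ q = 1 ∨ q = 2 ∨ q = 3 ∨ q = 4) := by
    refine ⟨_, rfl, ?_⟩
    have := bd 0
    simp at this
    omega
  obtain ⟨q, hq1, hq2⟩ := hc
  rw [hq1] at hq
  rcases hq2 with rfl | rfl | rfl | rfl | rfl
  · have a1 : m ∣ x := hh_zero_all hm (fun i => by have := bd i; have := hq i; omega)
    have a2 : m ∣ y := hh_zero_all hm (fun i => by have := bd i; have := hq i; omega)
    have a3 : m ∣ w := hh_zero_all hm (fun i => by have := bd i; have := hq i; omega)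
    exact Or.inl ⟨Int.dvd_sub a1 a2, Int.dvd_add a1 a3⟩
  · right
    have a3 : m ∣ w := hh_zero_all hm (fun i => by have := bd i; have := hq i; omega)
    have a1 : x % m + y % m = m := hh_ne_all hm (fun i => by have := bd i; have := hq i; omega)
    refine ⟨a3, ?_⟩
    obtain ⟨_, _, k1, h1⟩ := emod_rg hm x
    obtain ⟨_, _, k2, h2⟩ := emod_rg hm y
    exact ⟨k1 + k2 + 1, by linear_combination h1 + h2 + a1⟩
  · left
    have a3 : x % m = y % m := hh_eq_all hm (fun i => by have := bd i; have := hq i; omega)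
    have a1 : x % m + w % m = m := hh_ne_all hm (fun i => by have := bd i; have := hq i; omega)
    refine ⟨dvd_of_emod_eq a3, ?_⟩
    obtain ⟨_, _, k1, h1⟩ := emod_rg hm x
    obtain ⟨_, _, k2, h2⟩ := emod_rg hm w
    exact ⟨k1 + k2 + 1, by linear_combination h1 + h2 + a1⟩
  · exact (hh_one_all (a := w) hm (fun i => by have := bd i; have := hq i; omega)).elim
  · exact (hh_one_all (a := w) hm (fun i => by have := bd i; have := hq i; omega)).elim

lemma RR_lift {L x y w : ℤ} (hL0 : 0 < L) (hx : x % 2 = 1)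
    (h : RR (2 * L) x y w) (h1 : L ∣ x - y) (h2 : L ∣ x + w) : (2 * L ∣ x - y ∧ 2 * L ∣ x + w) := by
  have h3 := h 1 isCoprime_one_left
  simp only [one_mul] at h3
  obtain ⟨x0, x1, kx, hkx⟩ := emod_rg (m := 2 * L) (by omega) x
  obtain ⟨y0, y1, ky, hky⟩ := emod_rg (m := 2 * L) (by omega) y
  obtain ⟨w0, w1, kw, hkw⟩ := emod_rg (m := 2 * L) (by omega) w
  have hX : x % (2 * L) ≠ 0 := by
    intro h; have h := Int.dvd_of_emod_eq_zero h
    have : (2 : ℤ) ∣ x := (Dvd.intro _ rfl : (2:ℤ) ∣ 2 * L).trans h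
    omega
  obtain ⟨s, hs⟩ := h1
  obtain ⟨t, ht⟩ := h2
  generalize x % (2 * L) = X at *
  generalize y % (2 * L) = Y at *
  generalize w % (2 * L) = W at *
  have e1 : X - Y = L * (s - 2 * kx + 2 * ky) := by linear_combination hs - hkx + hky
  have e2 : X + W = L * (t - 2 * kx - 2 * kw) := by linear_combination ht - hkx - hkw
  generalize hS : s - 2 * kx + 2 * ky = S at *
  generalize hT : t - 2 * kx - 2 * kw = T at *
  have b1 : -2 < S := by by_contra h; push Not at h; nlinarith
  have b2 : S < 2 := by by_contra h; push Not at h; nlinarith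
  have b3 : L * (2 * T - S) = L * 4 := by linarith
  have b4 := mul_left_cancel₀ hL0.ne' b3
  have : S = 0 ∧ T = 2 := by omega
  obtain ⟨rfl, rfl⟩ := this
  exact ⟨⟨kx - ky, by linear_combination hkx - hky + e1⟩, ⟨kx + kw + 1, by linear_combination hkx + hkw + e2⟩⟩

lemma emod4 {m : ℤ} (hm : 0 < m) (w : ℤ) :
    (4 * (w % m) < 3 * m ∧ (4 * w + m) % (4 * m) = 4 * (w % m) + m) ∨
    (3 * m ≤ 4 * (w % m) ∧ (4 * w + m) % (4 * m) = 4 * (w % m) - 3 * m) := by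
  obtain ⟨h0, h1, k, hk⟩ := emod_rg hm w
  by_cases h : 4 * (w % m) < 3 * m
  · left; exact ⟨h, emod_uniq (by omega) (by omega) ⟨k, by linear_combination 4 * hk⟩⟩
  · right; exact ⟨by omega, emod_uniq (by omega) (by omega) ⟨k + 1, by linear_combination 4 * hk⟩⟩

lemma emod4' {m : ℤ} (hm : 0 < m) (w : ℤ) :
    (4 * (w % m) < m ∧ (4 * w + 3 * m) % (4 * m) = 4 * (w % m) + 3 * m) ∨
    (m ≤ 4 * (w % m) ∧ (4 * w + 3 * m) % (4 * m) = 4 * (w % m) - m) := by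
  obtain ⟨h0, h1, k, hk⟩ := emod_rg hm w
  by_cases h : 4 * (w % m) < m
  · left; exact ⟨h, emod_uniq (by omega) (by omega) ⟨k, by linear_combination 4 * hk⟩⟩
  · right; exact ⟨by omega, emod_uniq (by omega) (by omega) ⟨k + 1, by linear_combination 4 * hk⟩⟩

/-- indicator of the middle half -/
def KK (m w : ℤ) : ℤ := if m ≤ 4 * (w % m) ∧ 4 * (w % m) < 3 * m then 1 else 0

lemma KK_cases (m w : ℤ) : (KK m w = 1 ∧ m ≤ 4 * (w % m) ∧ 4 * (w % m) < 3 * m) ∨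
    (KK m w = 0 ∧ (4 * (w % m) < m ∨ 3 * m ≤ 4 * (w % m))) := by
  unfold KK; split_ifs with h
  · left; exact ⟨rfl, h⟩
  · right; exact ⟨rfl, by omega⟩

lemma KK_hh {m : ℤ} (hm : 0 < m) (w : ℤ) :
    (KK m w = 0 ∧ hh m (2 * w) = hh m w) ∨ (KK m w = 1 ∧ hh m (2 * w) + hh m w = 1) := by
  have h1 := emod_dbl hm w
  have h2 := emod_rg hm w
  have h3 := hh_cases m (2 * w)
  rcases hh_cases m w with ⟨h, h'⟩ | ⟨h, h'⟩ <;> rw [h] at h1 ⊢ <;>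
  rcases KK_cases m w with h4 | h4 <;> omega

lemma hh4 {m : ℤ} (hm : 0 < m) (w : ℤ) : hh (4 * m) (4 * w + m) = KK m w := by
  have h2 := emod_rg hm w
  have h3 := hh_cases (4 * m) (4 * w + m)
  rcases emod4 hm w with ⟨h, h'⟩ | ⟨h, h'⟩ <;> rw [h'] at h3 <;>
  rcases KK_cases m w with h4 | h4 <;> omega

lemma hh4' {m : ℤ} (hm : 0 < m) (w : ℤ) : hh (4 * m) (4 * w + 3 * m) = 1 - KK m w := by
  have h2 := emod_rg hm w
  have h3 := hh_cases (4 * m) (4 * w + 3 * m)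
  rcases emod4' hm w with ⟨h, h'⟩ | ⟨h, h'⟩ <;> rw [h'] at h3 <;>
  rcases KK_cases m w with h4 | h4 <;> omega

lemma cop_base4 {m u : ℤ} (hodd : m % 2 = 1) (hu : IsCoprime u m) : IsCoprime (4 * u + m) (4 * m) := by
  have h := cop_base hodd ((cop_two hodd).mul_left hu)
  have h2 := cop_two_mul h (by omega)
  convert h2 using 1 <;> ring

lemma em4 {m : ℤ} (u x : ℤ) (hx : x % 4 = 1) : ((4 * u + m) * x) % (4 * m) = (4 * (u * x) + m) % (4 * m) :=
  emod_congr ⟨x / 4, by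
    have := Int.emod_add_mul_ediv x 4
    rw [hx] at this
    linear_combination m * (-this)⟩

lemma em4' {m : ℤ} (u x : ℤ) (hx : x % 4 = 3) : ((4 * u + m) * x) % (4 * m) = (4 * (u * x) + 3 * m) % (4 * m) :=
  emod_congr ⟨x / 4, by
    have := Int.emod_add_mul_ediv x 4
    rw [hx] at this
    linear_combination m * (-this)⟩

lemma RR_four {m x y w : ℤ} (hm : 0 < m) (hodd : m % 2 = 1) (hxy : x % 4 = y % 4) (hx : x % 2 = 1) (hw : w % 2 = 1)
    (h : RR (4 * m) x y w) (h1 : m ∣ w) (h2 : m ∣ x + y) : m ∣ 3 * x := by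
  by_cases hmx : m ∣ x
  · exact Dvd.dvd.mul_left hmx 3
  have key : ∃ κ : ℤ, ∀ i : ℕ, KK m (2 ^ i * x) = κ := by
    have hux : ∀ i : ℕ, ((2 ^ i * x) % m ≠ 0 ∧ (2 ^ i * y) % m = m - (2 ^ i * x) % m) ∧ (2 ^ i * w) % m = 0 := by
      intro i
      have nd : ¬ m ∣ 2 ^ i * x := fun h => hmx (dvd_of_cop_mul (cop_two_pow hodd i) h)
      refine ⟨⟨emod_ne_zero nd, ?_⟩, Int.emod_eq_zero_of_dvd (Dvd.dvd.mul_left h1 _)⟩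
      rw [← emod_negg hm nd]
      apply emod_congr
      obtain ⟨s, hs⟩ := h2
      exact ⟨2 ^ i * s, by linear_combination 2 ^ i * hs⟩
    have hR : ∀ i : ℕ, _ := fun i => h _ (cop_base4 hodd (cop_two_pow hodd i))
    have hx4 : x % 4 = 1 ∨ x % 4 = 3 := by omega
    have hw4 : w % 4 = 1 ∨ w % 4 = 3 := by omega
    rcases hx4 with hx4 | hx4 <;> rcases hw4 with hw4 | hw4
    · refine ⟨1, fun i => ?_⟩
      have h3 := hR i
      have h4 := hux i
      rw [em4 _ _ hx4, em4 _ y (by omega), em4 _ _ hw4] at h3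
      have := emod4 hm (2 ^ i * x)
      have := emod4 hm (2 ^ i * y)
      have := emod4 hm (2 ^ i * w)
      have := KK_cases m (2 ^ i * x)
      omega
    · refine ⟨0, fun i => ?_⟩
      have h3 := hR i
      have h4 := hux i
      rw [em4 _ _ hx4, em4 _ y (by omega), em4' _ _ hw4] at h3
      have := emod4 hm (2 ^ i * x)
      have := emod4 hm (2 ^ i * y)
      have := emod4' hm (2 ^ i * w)
      have := KK_cases m (2 ^ i * x)
      omega
    · refine ⟨0, fun i => ?_⟩
      have h3 := hR i
      have h4 := hux i
      rw [em4' _ _ hx4, em4' _ y (by omega), em4 _ _ hw4] at h3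
      have := emod4' hm (2 ^ i * x)
      have := emod4' hm (2 ^ i * y)
      have := emod4 hm (2 ^ i * w)
      have := KK_cases m (2 ^ i * x)
      omega
    · refine ⟨1, fun i => ?_⟩
      have h3 := hR i
      have h4 := hux i
      rw [em4' _ _ hx4, em4' _ y (by omega), em4' _ _ hw4] at h3
      have := emod4' hm (2 ^ i * x)
      have := emod4' hm (2 ^ i * y)
      have := emod4' hm (2 ^ i * w)
      have := KK_cases m (2 ^ i * x)
      omega
  obtain ⟨κ, hκ⟩ := key
  have h01 : κ = 0 ∨ κ = 1 := by
    have := hκ 0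
    rcases KK_cases m (2 ^ 0 * x) with h | h <;> omega
  rcases h01 with rfl | rfl
  · have hc : ∀ i : ℕ, hh m (2 ^ i * x) = hh m x := by
      intro i
      induction i with
      | zero => simp
      | succ i ih =>
        rw [two_pow_succ_mul, ← ih]
        have := hκ i
        rcases KK_hh hm (2 ^ i * x) with h | h <;> omega
    rcases hh_cases m x with h | h
    · exact (hmx (hh_zero_all hm (fun i => by rw [hc i, h.1]))).elim
    · exact (hh_one_all hm (fun i => by rw [hc i, h.1])).elim
  · have : x % m + (2 * x) % m = m := by
      apply hh_ne_all hm
      intro i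
      have := hκ i
      rw [show (2 : ℤ) ^ i * (2 * x) = 2 * (2 ^ i * x) by ring]
      rcases KK_hh hm (2 ^ i * x) with h | h <;> omega
    obtain ⟨_, _, k1, h1⟩ := emod_rg hm x
    obtain ⟨_, _, k2, h2⟩ := emod_rg hm (2 * x)
    exact ⟨k1 + k2 + 1, by linear_combination h1 + h2 + this⟩


lemma pow_between {t : ℤ} (ht : 1 ≤ t) : ∃ I : ℕ, (2 : ℤ) ^ I ≤ t ∧ t < 2 ^ (I + 1) := by
  lift t to ℕ using by omega
  refine ⟨Nat.log 2 t, ?_, ?_⟩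
  · exact_mod_cast Nat.pow_log_le_self 2 (by omega)
  · exact_mod_cast Nat.lt_pow_succ_log_self (by norm_num) t

def EE (n x : ℤ) : Prop := ∀ l, IsCoprime l n → hh n (l * x) = hh n l

lemma alpha_K1 {m x : ℤ} (hm : 0 < m) (hodd : m % 2 = 1) (hx : x % 4 = 1) (h : EE (4 * m) x) (u : ℤ) (hu : IsCoprime u m) :
    KK m (u * x) = KK m u := by
  have h1 := h _ (cop_base4 hodd hu)
  rw [hh4 hm] at h1
  rw [← h1, ← hh4 hm]
  unfold hh; rw [em4 _ _ hx]

lemma alpha_K3 {m x : ℤ} (hm : 0 < m) (hodd : m % 2 = 1) (hx : x % 4 = 3) (h : EE (4 * m) x) (u : ℤ) (hu : IsCoprime u m) :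
    KK m (u * x) = 1 - KK m u := by
  have h1 := h _ (cop_base4 hodd hu)
  rw [hh4 hm] at h1
  have h2 := hh4' hm (u * x)
  have : hh (4 * m) (4 * (u * x) + 3 * m) = hh (4 * m) ((4 * u + m) * x) := by
    unfold hh; rw [em4' _ _ hx]
  rw [this, h1] at h2
  linarith

lemma alpha1 {m x : ℤ} (hm : 0 < m) (hodd : m % 2 = 1) (hx : x % 4 = 1) (h : EE (4 * m) x) :
    m ∣ x - 1 ∨ m ∣ x + 1 := by
  have hg : ∀ i : ℕ, (hh m (2 ^ i * x) = hh m (2 ^ i * 1) ↔ hh m x = hh m 1) := by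
    intro i
    induction i with
    | zero => simp
    | succ i ih =>
      rw [← ih, two_pow_succ_mul, two_pow_succ_mul]
      have h1 := alpha_K1 hm hodd hx h _ (cop_two_pow hodd i)
      have h2 := KK_hh hm (2 ^ i * x)
      have h3 := KK_hh hm (2 ^ i * 1)
      rw [mul_one] at *
      have := hh_bd m (2 ^ i * x)
      have := hh_bd m (2 ^ i)
      omega
  by_cases hc : hh m x = hh m 1
  · left
    exact dvd_of_emod_eq (hh_eq_all hm (fun i => (hg i).2 hc))
  · right
    have := hh_ne_all (a := x) (b := 1) hm (fun i => by
      have h1 : ¬ _ := fun h => hc ((hg i).1 h)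
      have := hh_bd m (2 ^ i * x)
      have := hh_bd m (2 ^ i * 1)
      omega)
    obtain ⟨_, _, k1, h1⟩ := emod_rg hm x
    obtain ⟨_, _, k2, h2⟩ := emod_rg hm 1
    exact ⟨k1 + k2 + 1, by linear_combination h1 + h2 + this⟩

lemma alpha3_Z {m x : ℤ} (hm : 40 < m) (hodd : m % 2 = 1) (hx : x % 4 = 3) (h : EE (4 * m) x) :
    ∃ Z : ℤ, -3 ≤ Z ∧ Z ≤ 3 ∧ 3 * (x % m) = Z + m * (1 + hh m x) := by
  have hm0 : 0 < m := by omega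
  obtain ⟨I, hI1, hI2⟩ := pow_between (t := (m - 1) / 4) (by omega)
  set Z : ℕ → ℤ := fun i => 3 * ((2 ^ i * x) % m) - m * (1 + hh m (2 ^ i * x)) with hZ
  have hK : ∀ i ≤ I, KK m (2 ^ i * x) = 1 := by
    intro i hi
    rw [alpha_K3 hm0 hodd hx h _ (cop_two_pow hodd i)]
    have h1 : (2 : ℤ) ^ i ≤ 2 ^ I := pow_le_pow_right₀ (by norm_num) hi
    have h2 : (0 : ℤ) < 2 ^ i := by positivity
    have h3 : (2 : ℤ) ^ i % m = 2 ^ i := Int.emod_eq_of_lt (by omega) (by omega)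
    have := KK_cases m (2 ^ i)
    omega
  have hZs : ∀ i ≤ I, Z i = 2 ^ i * Z 0 := by
    intro i
    induction i with
    | zero => simp
    | succ i ih =>
      intro hi
      have h1 := hK i (by omega)
      have h2 := KK_hh hm0 (2 ^ i * x)
      have h3 : hh m (2 * (2 ^ i * x)) = 1 - hh m (2 ^ i * x) := by omega
      have h4 := ih (by omega)
      rw [pow_succ, mul_comm ((2:ℤ) ^ i) 2, mul_assoc, ← h4]
      simp only [hZ, two_pow_succ_mul]
      rw [emod_dbl hm0, h3]
      ring
  have hb : -m < 2 * Z I ∧ 2 * Z I < m := by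
    have h1 := hK I le_rfl
    have h2 := KK_cases m (2 ^ I * x)
    have h3 := hh_cases m (2 ^ I * x)
    simp only [hZ]
    rcases h3 with ⟨h3, h3'⟩ | ⟨h3, h3'⟩ <;> rw [h3] <;> constructor <;> omega
  rw [hZs I le_rfl] at hb
  rw [pow_succ] at hI2
  have h2 : (0 : ℤ) < 2 ^ I := by positivity
  have hm8 : m ≤ 8 * 2 ^ I := by omega
  refine ⟨Z 0, ?_, ?_, ?_⟩
  · by_contra hc; push Not at hc; nlinarith
  · by_contra hc; push Not at hc; nlinarith
  · simp [hZ]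

lemma KK_val {m w r : ℤ} (h : m ∣ w - r) (h1 : m ≤ 4 * r) (h2 : 4 * r < 3 * m) (hm : 0 < m): KK m w = 1 := by
  have : w % m = r := emod_uniq (by omega) (by omega) h
  unfold KK; rw [this, if_pos ⟨h1, h2⟩]

lemma KK_neg {m w : ℤ} (hm : 0 < m) (hodd : m % 2 = 1) : KK m (-w) = KK m w := by
  by_cases h : m ∣ w
  · have h1 : m ∣ -w := by simpa using h
    have := Int.emod_eq_zero_of_dvd h
    have := Int.emod_eq_zero_of_dvd h1
    unfold KK; rw [‹w % m = 0›, ‹-w % m = 0›]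
  · have h1 := emod_negg hm h
    have := KK_cases m w
    have := KK_cases m (-w)
    omega

lemma no_q {m q x t : ℤ} (hm : m = 3 * q) (hq : 13 ≤ q) (hodd : m % 2 = 1) (ht : t = 1 ∨ t = -1)
    (hx : m ∣ x - (q + t)) (hK : ∀ u, IsCoprime u m → KK m (u * x) = 1 - KK m u) : False := by
  have main : ∀ u, IsCoprime u q → 3 * q < 4 * u → 4 * u < 5 * q → (t = 1 ∧ u % 3 = 1 ∨ t = -1 ∧ u % 3 = 2) → False := by
    intro u hu h1 h2 h3
    have hu3 : IsCoprime u m := by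
      rw [hm]
      apply IsCoprime.mul_right _ hu
      exact ((Int.prime_three.coprime_iff_not_dvd).2 (by omega)).symm
    have k1 : KK m u = 1 := KK_val (r := u) (by simp) (by omega) (by omega) (by omega)
    have k2 := hK u hu3
    obtain ⟨s, hs⟩ := hx
    have hd := Int.emod_add_mul_ediv u 3
    rcases h3 with ⟨rfl, h3⟩ | ⟨rfl, h3⟩
    · have k3 : KK m (u * x) = 1 := KK_val (r := q + u) ⟨u * s + u / 3, by rw [hm] at *; rw [h3] at hd; linear_combination u * hs - q * hd⟩ (by omega) (by omega) (by omega)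
      omega
    · have k3 : KK m (u * x) = 1 := KK_val (r := 2 * q - u) ⟨u * s + u / 3, by rw [hm] at *; rw [h3] at hd; linear_combination u * hs - q * hd⟩ (by omega) (by omega) (by omega)
      omega
  have cq : ∀ j, IsCoprime j q → IsCoprime (q + j) q := fun j hj => cop_congr (x := j) ⟨-1, by ring⟩ hj
  have c1 : IsCoprime (1 : ℤ) q := isCoprime_one_left
  have c1' : IsCoprime (-1 : ℤ) q := c1.neg_left
  have c3 : q % 3 ≠ 0 → IsCoprime (3 : ℤ) q := fun h => (Int.prime_three.coprime_iff_not_dvd).2 (by omega)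
  have hq3 : q % 3 = 0 ∨ q % 3 = 1 ∨ q % 3 = 2 := by omega
  rcases ht with rfl | rfl <;> rcases hq3 with h | h | h
  · exact main _ (cq _ c1) (by omega) (by omega) (by omega)
  · exact main _ (cq _ (c3 (by omega))) (by omega) (by omega) (by omega)
  · exact main _ (cq _ c1') (by omega) (by omega) (by omega)
  · exact main _ (cq _ c1') (by omega) (by omega) (by omega)
  · exact main _ (cq _ c1) (by omega) (by omega) (by omega)
  · exact main _ (cq _ (c3 (by omega))) (by omega) (by omega) (by omega)

lemma alpha3 {m x : ℤ} (hm : 40 < m) (hodd : m % 2 = 1) (hx : x % 4 = 3) (h : EE (4 * m) x)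
    (hT : m ∣ 3 * x ^ 2 - 3 ∨ m ∣ x ^ 2 - 3) : False := by
  have hm0 : 0 < m := by omega
  obtain ⟨Z, hZ1, hZ2, hZ⟩ := alpha3_Z hm hodd hx h
  obtain ⟨_, _, k, hk⟩ := emod_rg hm0 x
  rcases hT with ⟨t, ht⟩ | ⟨t, ht⟩
  · have hd : m ∣ 9 - Z ^ 2 := by
      refine ⟨-3 * t + (1 + hh m x + 3 * k) * (3 * x + Z), ?_⟩
      have : 3 * x = Z + m * (1 + hh m x + 3 * k) := by linear_combination hZ + 3 * hk
      linear_combination (-3) * ht + (3 * x + Z) * this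
    have hz : 9 - Z ^ 2 = 0 := by
      have hle : Z ^ 2 ≤ 9 := by nlinarith
      exact Int.eq_zero_of_dvd_of_nonneg_of_lt (by omega) (by have := sq_nonneg Z; omega) hd
    have hZ3 : Z = 3 ∨ Z = -3 := by
      have : (Z - 3) * (Z + 3) = 0 := by linear_combination -hz
      rcases mul_eq_zero.1 this with h | h <;> omega
    have hK := fun u hu => alpha_K3 hm0 hodd hx h u hu
    rcases hh_cases m x with ⟨e, e'⟩ | ⟨e, e'⟩ <;> rw [e] at hZ
    · obtain ⟨q, hq⟩ : ∃ q, m = 3 * q := ⟨m / 3, by omega⟩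
      refine no_q (t := Z / 3) hq (by omega) hodd (by omega) ⟨k, ?_⟩ hK
      have : x % m = q + Z / 3 := by omega
      linear_combination hk + this
    · obtain ⟨q, hq⟩ : ∃ q, m = 3 * q := ⟨m / 3, by omega⟩
      refine no_q (x := -x) (t := -(Z / 3)) hq (by omega) hodd (by omega) ⟨-k - 1, ?_⟩ ?_
      · have : x % m = 2 * q + Z / 3 := by omega
        linear_combination -hk - this + hq
      · intro u hu
        rw [mul_neg, KK_neg hm0 hodd, hK u hu]
  · have hd : m ∣ 27 - Z ^ 2 := by
      refine ⟨-9 * t + (1 + hh m x + 3 * k) * (3 * x + Z), ?_⟩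
      have : 3 * x = Z + m * (1 + hh m x + 3 * k) := by linear_combination hZ + 3 * hk
      linear_combination (-9) * ht + (3 * x + Z) * this
    have hle : Z ^ 2 ≤ 9 := by nlinarith
    have := Int.le_of_dvd (by omega) hd
    have := sq_nonneg Z
    omega

lemma hh_quarter {L : ℤ} (hL : 0 < L) (w : ℤ) :
    (hh (2 * L) w = 0 ∧ hh (4 * L) (w + L) = hh (4 * L) w) ∨ (hh (2 * L) w = 1 ∧ hh (4 * L) (w + L) + hh (4 * L) w = 1) := by
  obtain ⟨h0, h1, k, hk⟩ := emod_rg (m := 4 * L) (by omega) w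
  have a1 : (w % (4 * L) < 2 * L ∧ w % (2 * L) = w % (4 * L)) ∨ (2 * L ≤ w % (4 * L) ∧ w % (2 * L) = w % (4 * L) - 2 * L) := by
    by_cases h : w % (4 * L) < 2 * L
    · left; exact ⟨h, emod_uniq (by omega) (by omega) ⟨2 * k, by linear_combination hk⟩⟩
    · right; exact ⟨by omega, emod_uniq (by omega) (by omega) ⟨2 * k + 1, by linear_combination hk⟩⟩
  have a2 : (w % (4 * L) < 3 * L ∧ (w + L) % (4 * L) = w % (4 * L) + L) ∨ (3 * L ≤ w % (4 * L) ∧ (w + L) % (4 * L) = w % (4 * L) - 3 * L) := by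
    by_cases h : w % (4 * L) < 3 * L
    · left; exact ⟨h, emod_uniq (by omega) (by omega) ⟨k, by linear_combination hk⟩⟩
    · right; exact ⟨by omega, emod_uniq (by omega) (by omega) ⟨k + 1, by linear_combination hk⟩⟩
  have h3 := hh_cases (2 * L) w
  have h4 := hh_cases (4 * L) w
  have h5 := hh_cases (4 * L) (w + L)
  omega

/-- descent of `EE` from `4L` to `2L`, `L` even -/
lemma EE_desc {L x : ℤ} (hL : 0 < L) (hL2 : L % 2 = 0) (hx : x % 4 = 1) (h : EE (4 * L) x) : EE (2 * L) x := by
  intro l hl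
  have hl1 : IsCoprime l L := hl.of_mul_right_right
  have c4 : ∀ u, IsCoprime u L → IsCoprime u (4 * L) := fun u hu => by
    have := cop_two_mul (cop_two_mul hu hL2) (by omega)
    convert this using 1; ring
  have h1 := h l (c4 _ hl1)
  have h2 := h (l + L) (c4 _ (cop_congr (x := l) ⟨-1, by ring⟩ hl1))
  have e : hh (4 * L) ((l + L) * x) = hh (4 * L) (l * x + L) := hh_congr ⟨x / 4, by
    have := Int.emod_add_mul_ediv x 4
    rw [hx] at this
    linear_combination -L * this⟩
  rw [e] at h2
  have q1 := hh_quarter hL l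
  have q2 := hh_quarter hL (l * x)
  have := hh_bd (4 * L) l
  have := hh_bd (4 * L) (l + L)
  omega

lemma hh_lift {L x a : ℤ} (_hL : 0 < L) (ha0 : 0 ≤ a) (ha : a < L) (h : L ∣ x - a) (hz : hh (2 * L) x = 0) : 2 * L ∣ x - a := by
  obtain ⟨k, hk⟩ := h
  have : k % 2 = 0 ∨ k % 2 = 1 := by omega
  rcases this with h1 | h1
  · exact ⟨k / 2, by
      have := Int.emod_add_mul_ediv k 2
      rw [h1] at this
      linear_combination hk - L * this⟩
  · exfalso
    rw [hh_congr (y := a + L) ⟨k / 2, by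
      have := Int.emod_add_mul_ediv k 2
      rw [h1] at this
      linear_combination hk - L * this⟩, hh_hi (by omega) (by omega)] at hz
    omega

lemma EE_one {n x : ℤ} (h : EE n x) (hn : 2 < n) : hh n x = 0 := by
  have := h 1 isCoprime_one_left
  rw [one_mul] at this
  rw [this]; exact hh_lo (by norm_num) (by omega)

lemma beta {m : ℤ} (hm : 0 < m) (hodd : m % 2 = 1) {x : ℤ} (hx : x % 4 = 1) (k : ℕ) :
    EE (2 ^ k * (4 * m)) x → (2 ^ k * (4 * m) ∣ x - 1) ∨ (k = 0 ∧ 4 * m ∣ x - (2 * m - 1)) ∨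
      (k = 1 ∧ m = 3 ∧ 24 ∣ x - 5) := by
  induction k with
  | zero =>
    intro h
    simp only [pow_zero, one_mul] at h ⊢
    rcases alpha1 hm hodd hx h with h1 | h1
    · left
      have c4 : IsCoprime (4 : ℤ) m := by
        have := (cop_two hodd).mul_left (cop_two hodd); norm_num at this; exact this
      exact c4.mul_dvd (by omega) h1
    · right; left
      refine ⟨by simp, ?_⟩
      have c4 : IsCoprime (4 : ℤ) m := by
        have := (cop_two hodd).mul_left (cop_two hodd); norm_num at this; exact this
      refine c4.mul_dvd (by omega) ?_
      obtain ⟨s, hs⟩ := h1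
      exact ⟨s - 2, by linear_combination hs⟩
  | succ k ih =>
    intro h
    have p0 : (0 : ℤ) < 2 ^ k * (2 * m) := by positivity
    have h' : EE (4 * (2 ^ k * (2 * m))) x := by
      convert h using 1; ring
    have hd := EE_desc p0 (by rw [mul_left_comm]; omega) hx h'
    have hd' : EE (2 ^ k * (4 * m)) x := by convert hd using 1; ring
    have hz : hh (2 * (2 ^ k * (4 * m))) x = 0 := by
      have : 2 * (2 ^ k * (4 * m)) = 2 ^ (k + 1) * (4 * m) := by ring
      rw [this]
      apply EE_one h
      rw [← this]
      have : (0 : ℤ) < 2 ^ k * m := by positivity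
      nlinarith
    have p1 : (4 : ℤ) ≤ 2 ^ k * (4 * m) := by
      have : (0 : ℤ) < 2 ^ k * m := by positivity
      nlinarith
    rcases ih hd' with h1 | ⟨rfl, h1⟩ | ⟨rfl, rfl, h1⟩
    · left
      have := hh_lift (by omega) (by norm_num) (by omega) h1 hz
      convert this using 1; ring
    · simp only [pow_zero, one_mul] at hz
      have h2 := hh_lift (by omega) (by omega) (by omega) h1 hz
      have hm1 : m = 1 ∨ m = 3 ∨ (m % 4 = 1 ∧ 5 ≤ m) ∨ (m % 4 = 3 ∧ 7 ≤ m) := by omega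
      have hE : EE (8 * m) x := by convert h using 1; ring
      have main : ∀ l, l % 4 = 1 → IsCoprime l m → 2 * m < l → l < 4 * m → False := by
        intro l hl4 hlm hl1 hl2
        have hc : IsCoprime l (8 * m) := by
          refine IsCoprime.mul_right ?_ hlm
          have : IsCoprime l 2 := (cop_two (by omega)).symm
          have := this.pow_right (n := 3)
          norm_num at this; exact this
        have e1 := hE l hc
        obtain ⟨s, hs⟩ := h2
        rw [hh_lo (x := l) (by omega) (by omega), hh_congr (y := 10 * m - l) ⟨l * s + l / 4 - 1, by
          have := Int.emod_add_mul_ediv l 4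
          rw [hl4] at this
          linear_combination l * hs - 2 * m * this⟩, hh_hi (by omega) (by omega)] at e1
        omega
      have cm : IsCoprime (-2 : ℤ) m := (cop_two hodd).neg_left
      have cm4 : IsCoprime (-4 : ℤ) m := by
        have := (cop_two hodd).mul_left (cop_two hodd); norm_num at this; exact this.neg_left
      rcases hm1 with rfl | rfl | ⟨h3, h4⟩ | ⟨h3, h4⟩
      · left; norm_num at h2 ⊢; exact h2
      · right; right; norm_num at h2 ⊢; exact h2
      · exact (main (3 * m - 2) (by omega) (cop_congr (x := -2) ⟨-3, by ring⟩ cm) (by omega) (by omega)).elim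
      · exact (main (3 * m - 4) (by omega) (cop_congr (x := -4) ⟨-3, by ring⟩ cm4) (by omega) (by omega)).elim
    · exfalso
      norm_num at hz h
      have h2 := hh_lift (L := 24) (by omega) (by omega) (by omega) h1 (by norm_num; exact hz)
      obtain ⟨s, hs⟩ := h2
      have e1 := h 5 (by rw [Int.isCoprime_iff_gcd_eq_one]; decide)
      rw [hh_lo (x := 5) (by omega) (by omega), hh_congr (y := 25) ⟨5 * s, by linear_combination 5 * hs⟩, hh_hi (by omega) (by omega)] at e1
      omega


lemma RR_chain {m x y w : ℤ} (hm : 0 < m) (hx : x % 2 = 1) (hy : y % 2 = 1) (hw : w % 2 = 1) (k : ℕ) :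
    RR (2 ^ k * (2 * m)) x y w → RR (2 * m) x y w ∧ (1 ≤ k → RR (4 * m) x y w) ∧
     ((m ∣ x - y ∧ m ∣ x + w) → (2 ^ k * (2 * m) ∣ x - y ∧ 2 ^ k * (2 * m) ∣ x + w)) := by
  induction k with
  | zero =>
    intro h
    simp only [pow_zero, one_mul] at h ⊢
    exact ⟨h, by omega, fun hA => RR_lift hm hx h hA.1 hA.2⟩
  | succ k ih =>
    intro h
    have e : (2 : ℤ) ^ (k + 1) * (2 * m) = 2 * (2 ^ k * (2 * m)) := by ring
    have p : (0 : ℤ) < 2 ^ k * (2 * m) := by positivity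
    rw [e] at h ⊢
    have hd := RR_desc p (by rw [mul_left_comm]; omega) hx hy hw h
    obtain ⟨h1, h2, h3⟩ := ih hd
    refine ⟨h1, fun _ => ?_, fun hA => ?_⟩
    · rcases Nat.eq_zero_or_pos k with rfl | hk
      · convert h using 1; ring
      · exact h2 hk
    · obtain ⟨a1, a2⟩ := h3 hA
      exact RR_lift p hx h a1 a2

lemma two_pow_decomp {t : ℤ} (ht : 0 < t) : ∃ (k : ℕ) (m : ℤ), t = 2 ^ k * m ∧ m % 2 = 1 := by
  lift t to ℕ using by omega
  obtain ⟨k, m, hm, h⟩ := Nat.exists_eq_two_pow_mul_odd (n := t) (by omega)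
  refine ⟨k, m, by exact_mod_cast h, ?_⟩
  have := Nat.odd_iff.1 hm
  omega

lemma EE_neg {M x : ℤ} (hM0 : 0 < M) (hM : M % 2 = 0) (hx : x % 2 = 1) (h : EE (2 * M) x) : EE (2 * M) (M - x) := by
  intro l hl
  have h1 := h l hl
  have hlo := cop_odd hl (by omega)
  rw [← h1]
  have nd : (l * x) % (2 * M) % 2 = 1 := by
    rw [Int.emod_emod_of_dvd _ (Dvd.intro _ rfl), Int.mul_emod, hlo, hx]; rfl
  have e : hh (2 * M) (l * (M - x)) = hh (2 * M) (M - l * x) := hh_congr ⟨l / 2, by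
    have := Int.emod_add_mul_ediv l 2
    rw [hlo] at this
    linear_combination -M * this⟩
  rw [e]
  obtain ⟨h2, h3, k, hk⟩ := emod_rg (m := 2 * M) (by omega) (l * x)
  rcases hh_cases (2 * M) (l * x) with ⟨f, f'⟩ | ⟨f, f'⟩ <;> rw [f]
  · rw [hh_congr (y := M - (l * x) % (2 * M)) ⟨-k, by linear_combination -hk⟩]
    exact hh_lo (by omega) (by omega)
  · rw [hh_congr (y := 3 * M - (l * x) % (2 * M)) ⟨-k - 1, by linear_combination -hk⟩]
    exact hh_hi (by omega) (by omega)

lemma caseIII_core {n x y z : ℤ} (H : Hyp n x y z) (h4 : n % 4 = 0) (hbig : 160 < n)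
    (hx : x % 2 = 1) (hy : y % 2 = 1) (hz : z % 2 = 0) : (x = 1 ∧ y = 1) ∨ (2 * x = n - 2 ∧ 2 * y = n - 2) := by
  obtain ⟨k, m, hkm, hodd⟩ := two_pow_decomp (t := n / 4) (by omega)
  have hn : n = 2 * (2 ^ k * (2 * m)) := by
    have : n = 4 * (n / 4) := by omega
    rw [this, hkm]; ring
  have hm : 0 < m := by
    by_contra h; push Not at h
    have : (0:ℤ) < 2 ^ k := by positivity
    nlinarith
  obtain ⟨w, rfl⟩ : ∃ w, z = 2 * w := ⟨z / 2, by omega⟩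
  set M := (2 : ℤ) ^ k * (2 * m) with hM
  have hM2 : M % 2 = 0 := by omega
  have hM0 : 0 < M := by omega
  obtain ⟨t, ht⟩ := H.T
  have hsum := H.hsum
  have hx0 := H.ha
  have hy0 := H.hb
  have hz0 := H.hc
  -- parity facts
  have hpar : x % 4 = y % 4 ∧ w % 2 = 1 := by
    obtain ⟨x', rfl⟩ : ∃ x', x = 2 * x' + 1 := ⟨x / 2, by omega⟩
    obtain ⟨y', rfl⟩ : ∃ y', y = 2 * y' + 1 := ⟨y / 2, by omega⟩
    obtain ⟨N, rfl⟩ : ∃ N, n = 4 * N := ⟨n / 4, by omega⟩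
    have e : 4 * (x' * y' + w * (y' + 1) + w * x' - N * t + 1) + 2 * x' + 2 * y' = 0 := by linear_combination ht
    omega
  obtain ⟨hxy4, hw⟩ := hpar
  have hR : RR M x y w := RR_top hM2 hx hy (by rw [← hn]; exact H)
  obtain ⟨hR2, hR4, hlift⟩ := RR_chain hm hx hy hw k hR
  have hmM : m ∣ n := ⟨4 * 2 ^ k, by rw [hn, hM]; ring⟩
  obtain ⟨g, hg⟩ := hmM
  have hdich : (m ∣ x - y ∧ m ∣ x + w) ∨ (k = 0 ∧ m ∣ w ∧ m ∣ x + y) := by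
    rcases RR_base hm hodd hx hy hw hR2 with hA | ⟨hB1, hB2⟩
    · exact Or.inl hA
    rcases Nat.eq_zero_or_pos k with hk | hk
    · exact Or.inr ⟨hk, hB1, hB2⟩
    left
    obtain ⟨s, hs⟩ := RR_four hm hodd hxy4 hx hw (hR4 hk) hB1 hB2
    obtain ⟨w', hw'⟩ := hB1
    obtain ⟨v, hv⟩ := hB2
    have hxx : m ∣ x ^ 2 - 3 := ⟨-t * g + x * v + 2 * w' * m * v, by
      rw [hg] at ht
      have hy' : y = m * v - x := by linarith
      rw [hw', hy'] at ht
      linear_combination -ht⟩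
    obtain ⟨r, hr⟩ := hxx
    have hm27 : m ∣ 27 := ⟨3 * s * x - 9 * r, by linear_combination 9 * (-hr) + 3 * x * hs⟩
    have hmle := Int.le_of_dvd (by norm_num) hm27
    have hm3 : m = 1 ∨ m = 3 ∨ 9 ∣ m := by
      obtain ⟨c, hc⟩ := hm27
      interval_cases m <;> omega
    have hmx : m ∣ x := by
      rcases hm3 with rfl | rfl | h9
      · exact one_dvd _
      · exact Int.prime_three.dvd_of_dvd_pow (n := 2) ⟨r + 1, by linear_combination hr⟩
      · exfalso
        have h2 : (9 : ℤ) ∣ x ^ 2 - 3 := h9.trans ⟨r, hr⟩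
        have h3 : (3 : ℤ) ∣ x := Int.prime_three.dvd_of_dvd_pow (n := 2) (by omega)
        obtain ⟨x', hx'⟩ := h3
        rw [hx'] at h2
        have : (3 * x') ^ 2 = 9 * x' ^ 2 := by ring
        rw [this] at h2
        omega
    exact ⟨by have := Int.dvd_sub hmx ((Int.dvd_add_right hmx).1 ⟨v, hv⟩); exact this,
      Int.dvd_add hmx ⟨w', hw'⟩⟩
  rcases hdich with hA | ⟨rfl, hB1, hB2⟩
  · -- branch A
    obtain ⟨⟨a1, ha1⟩, ⟨a2, ha2⟩⟩ := hlift hA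
    have hxy : x = y := by
      have hd : n ∣ x - y := ⟨a2 - 1, by rw [hn] at hsum ⊢; linear_combination 2 * ha2 - hsum⟩
      have h1 := emod_congr hd
      rwa [Int.emod_eq_of_lt (by omega) (by omega), Int.emod_eq_of_lt (by omega) (by omega)] at h1
    subst hxy
    have hE : EE n x := by
      intro l hl
      have s := H.SS l hl
      have nd : ¬ n ∣ 2 * (l * x) := by
        intro hd
        have h2 : n ∣ l * (2 * w) := by
          have : l * (2 * w) = l * n - 2 * (l * x) := by linear_combination l * hsum
          rw [this]; exact Int.dvd_sub (Dvd.intro_left _ rfl) hd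
        have := Int.le_of_dvd hz0 (unit_not_dvd hl h2)
        omega
      have e : (l * (2 * w)) % n = n - (2 * (l * x)) % n := by
        rw [← emod_negg (by omega) nd]
        exact emod_congr ⟨l, by linear_combination l * hsum⟩
      rw [e, emod_dbl (by omega)] at s
      have h2 : n * hh n (l * x) = n * hh n l := by linarith
      exact mul_left_cancel₀ (by omega) h2
    have hT3 : n ∣ 3 * x ^ 2 - 3 := ⟨-t + 2 * x, by linear_combination -ht + 2 * x * hsum⟩
    rcases Nat.eq_zero_or_pos k with rfl | hk
    · have hn4 : n = 4 * m := by rw [hn, hM]; ring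
      rw [hn4] at hE
      have : x % 4 = 1 ∨ x % 4 = 3 := by omega
      rcases this with h1 | h1
      · rcases beta hm hodd h1 0 (by simpa using hE) with h2 | ⟨-, h2⟩ | ⟨h2, -⟩
        · left
          rw [pow_zero, one_mul, ← hn4] at h2
          have h2 := emod_congr h2
          rw [Int.emod_eq_of_lt (by omega) (by omega), Int.emod_eq_of_lt (by omega) (by omega)] at h2
          exact ⟨h2, h2⟩
        · right
          rw [← hn4] at h2
          have h2 := emod_congr h2
          rw [Int.emod_eq_of_lt (by omega) (by omega), Int.emod_eq_of_lt (by omega) (by omega)] at h2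
          omega
        · omega
      · exact (alpha3 (by omega) hodd h1 hE (Or.inl ((Dvd.intro_left _ rfl : m ∣ 4 * m).trans (hn4 ▸ hT3)))).elim
    · have hn8 : n = 2 ^ k * (4 * m) := by rw [hn, hM]; ring
      have hM4 : M % 4 = 0 := by
        obtain ⟨j, rfl⟩ : ∃ j, k = j + 1 := ⟨k - 1, by omega⟩
        have : M = 4 * (2 ^ j * m) := by rw [hM]; ring
        omega
      have fin : ∀ x', x' % 4 = 1 → EE n x' → n ∣ x' - 1 := by
        intro x' h1 hE'
        rw [hn8] at hE'
        rcases beta hm hodd h1 k hE' with h2 | ⟨h2, -⟩ | ⟨rfl, rfl, -⟩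
        · rw [hn8]; exact h2
        · omega
        · omega
      have : x % 4 = 1 ∨ x % 4 = 3 := by omega
      rcases this with h1 | h1
      · left
        have h2 := emod_congr (fin x h1 hE)
        rw [Int.emod_eq_of_lt (by omega) (by omega), Int.emod_eq_of_lt (by omega) (by omega)] at h2
        exact ⟨h2, h2⟩
      · right
        have hE2 : EE n (M - x) := by rw [hn] at hE ⊢; exact EE_neg hM0 hM2 hx hE
        have hd := fin (M - x) (by omega) hE2
        have h2 : x % n = (M - 1) % n := by
          apply emod_congr
          obtain ⟨s, hs⟩ := hd
          exact ⟨-s, by linear_combination -hs⟩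
        rw [Int.emod_eq_of_lt (by omega) (by omega), Int.emod_eq_of_lt (by omega) (by omega)] at h2
        omega
  · -- branch B
    exfalso
    have hn4 : n = 4 * m := by rw [hn, hM]; ring
    have hwm : w = m := by
      obtain ⟨c, hc⟩ := hB1
      have c0 : 0 < c := by by_contra h; push Not at h; nlinarith
      have c1 : c < 2 := by by_contra h; push Not at h; nlinarith
      have : c = 1 := by omega
      rw [hc, this, mul_one]
    subst hwm
    have hE : EE (4 * w) x := by
      intro l hl
      have s := H.SS l (hn4 ▸ hl)
      rw [hn4] at s
      have hlo := cop_odd hl (by omega)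
      have hdiv := Int.emod_add_mul_ediv l 2
      rw [hlo] at hdiv
      have e1 : (l * (2 * w)) % (4 * w) = 2 * w := emod_uniq (by omega) (by omega) ⟨l / 2, by linear_combination -2 * w * hdiv⟩
      obtain ⟨h2, h3, j, hj⟩ := emod_rg (m := 4 * w) (by omega) (l * x)
      have nd : (l * x) % (4 * w) % 2 = 1 := by
        rw [Int.emod_emod_of_dvd _ ⟨2 * w, by ring⟩, Int.mul_emod, hlo, hx]; rfl
      have hy' : y = 2 * w - x := by linarith
      have e2 : ((l * x) % (4 * w) < 2 * w ∧ (l * y) % (4 * w) = 2 * w - (l * x) % (4 * w)) ∨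
        (2 * w < (l * x) % (4 * w) ∧ (l * y) % (4 * w) = 6 * w - (l * x) % (4 * w)) := by
        by_cases hlt : (l * x) % (4 * w) < 2 * w
        · left
          refine ⟨hlt, emod_uniq (by omega) (by omega) ⟨-j + l / 2, by rw [hy']; linear_combination -hj - 2 * w * hdiv⟩⟩
        · right
          refine ⟨by omega, emod_uniq (by omega) (by omega) ⟨-j + l / 2 - 1, by rw [hy']; linear_combination -hj - 2 * w * hdiv⟩⟩
      rw [e1] at s
      have h5 := hh_cases (4 * w) (l * x)
      rcases hh_cases (4 * w) l with ⟨h6, h6'⟩ | ⟨h6, h6'⟩ <;> rw [h6] at s ⊢ <;> omega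
    have hxx : w ∣ x ^ 2 - 3 := by
      obtain ⟨v, hv⟩ := hB2
      exact ⟨-4 * t + x * v + 2 * w * v, by
        rw [hn4] at ht
        have hy' : y = w * v - x := by linarith
        rw [hy'] at ht
        linear_combination -ht⟩
    have : x % 4 = 1 ∨ x % 4 = 3 := by omega
    rcases this with h1 | h1
    · have : w ∣ 2 := by
        obtain ⟨r, hr⟩ := hxx
        rcases alpha1 hm hodd h1 hE with ⟨s, hs⟩ | ⟨s, hs⟩
        · exact ⟨s * (x + 1) - r, by linear_combination (x + 1) * hs - hr⟩
        · exact ⟨s * (x - 1) - r, by linear_combination (x - 1) * hs - hr⟩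
      have := Int.le_of_dvd (by norm_num) this
      omega
    · exact alpha3 (by omega) hodd h1 hE (Or.inr hxx)

lemma Hyp.parity {n a b c : ℤ} (H : Hyp n a b c) (h2 : n % 2 = 0) :
    (a % 2 = 1 ∧ b % 2 = 1 ∧ c % 2 = 0) ∨ (b % 2 = 1 ∧ c % 2 = 1 ∧ a % 2 = 0) ∨ (c % 2 = 1 ∧ a % 2 = 1 ∧ b % 2 = 0) := by
  have hsum := H.hsum
  have hT : (2 : ℤ) ∣ a * b + b * c + c * a + 3 := (Int.dvd_of_emod_eq_zero h2).trans H.T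
  have : ¬ (a % 2 = 0 ∧ b % 2 = 0 ∧ c % 2 = 0) := by
    rintro ⟨h1, h3, h5⟩
    obtain ⟨a', rfl⟩ := Int.dvd_of_emod_eq_zero h1
    obtain ⟨b', rfl⟩ := Int.dvd_of_emod_eq_zero h3
    obtain ⟨c', rfl⟩ := Int.dvd_of_emod_eq_zero h5
    obtain ⟨t, ht⟩ := hT
    have : 2 * (t - 2 * (a' * b' + b' * c' + c' * a')) = 3 := by linear_combination -ht
    omega
  omega

lemma caseIII {n a b c : ℤ} (H : Hyp n a b c) (h4 : n % 4 = 0) (hbig : 160 < n) : Concl n a b c := by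
  rcases H.parity (by omega) with ⟨h1, h2, h3⟩ | ⟨h1, h2, h3⟩ | ⟨h1, h2, h3⟩
  · have := caseIII_core H h4 hbig h1 h2 h3
    unfold Concl; tauto
  · have := caseIII_core H.rot h4 hbig h1 h2 h3
    unfold Concl; tauto
  · have := caseIII_core H.rot.rot h4 hbig h1 h2 h3
    unfold Concl; tauto


structure H2 (m a b c : ℤ) : Prop where
  hm : 80 < m
  hodd : m % 2 = 1
  ndc : ¬ m ∣ c
  T : m ∣ a * b + b * c + c * a + 3
  sum : m ∣ a + b + c
  S : ∀ u, IsCoprime u m → (u * a) % m + (u * b) % m + (u * c) % m = m * (1 + hh m (u * a) + hh m (u * b) - hh m u)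

lemma H2.swap {m a b c : ℤ} (H : H2 m a b c) : H2 m b a c where
  hm := H.hm
  hodd := H.hodd
  ndc := H.ndc
  T := by have := H.T; ring_nf at this ⊢; exact this
  sum := by have := H.sum; rwa [add_comm b a]
  S := fun u hu => by have := H.S u hu; linarith

lemma H2_of {m a b c : ℤ} (H : Hyp (2 * m) a b c) (hm : 80 < m) (hodd : m % 2 = 1)
    (ha : a % 2 = 1) (hb : b % 2 = 1) (hc : c % 2 = 0) : H2 m a b c where
  hm := hm
  hodd := hodd
  ndc := by
    rintro ⟨k, hk⟩
    have h1 := H.ha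
    have h2 := H.hb
    have h3 := H.hc
    have h4 := H.hsum
    have c0 : 0 < k := by by_contra h; push Not at h; nlinarith
    have c1 : k < 2 := by by_contra h; push Not at h; nlinarith
    have : k = 1 := by omega
    subst this
    omega
  T := (Dvd.intro_left 2 rfl : m ∣ 2 * m).trans H.T
  sum := by rw [H.hsum]; exact Dvd.intro_left 2 rfl
  S := by
    intro u hu
    have hm0 : 0 < m := by omega
    have h1 := H.SS _ (cop_base hodd hu)
    rw [emod_two_add' hm0 _ _ ha, emod_two_add' hm0 _ _ hb] at h1
    have e : ((2 * u + m) * c) % (2 * m) = 2 * ((u * c) % m) := by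
      rw [← emod_two_mul hm0]
      exact emod_congr ⟨c / 2, by
        have := Int.emod_add_mul_ediv c 2
        rw [hc] at this
        linear_combination -m * this⟩
    have e2 : hh (2 * m) (2 * u + m) = 1 - hh m u := by
      have h2 := emod_two_add hm0 u
      have := emod_rg hm0 u
      have h3 := hh_cases (2 * m) (2 * u + m)
      rcases hh_cases m u with ⟨f, f'⟩ | ⟨f, f'⟩ <;> rw [f] at h2 ⊢ <;> omega
    rw [e, e2] at h1
    linarith

section
variable {m a b c : ℤ}

lemma H2.s12 (H : H2 m a b c) (u : ℤ) (hu : IsCoprime u m) :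
    1 ≤ 1 + hh m (u * a) + hh m (u * b) - hh m u ∧ 1 + hh m (u * a) + hh m (u * b) - hh m u ≤ 2 ∧ 0 < (u * c) % m := by
  have hm0 : 0 < m := by linarith [H.hm]
  have h := H.S u hu
  have h1 := emod_rg hm0 (u * a)
  have h2 := emod_rg hm0 (u * b)
  have h3 := emod_rg hm0 (u * c)
  have h4 : (u * c) % m ≠ 0 := emod_ne_zero (fun h => H.ndc (unit_not_dvd hu h))
  have h5 : 0 < (u * c) % m := by omega
  generalize 1 + hh m (u * a) + hh m (u * b) - hh m u = s at *
  refine ⟨?_, ?_, h5⟩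
  · by_contra hc; push Not at hc; nlinarith
  · by_contra hc; push Not at hc; nlinarith

/-- the auxiliary quantity `Y` -/
lemma H2.Y (H : H2 m a b c) (u : ℤ) (hu : IsCoprime u m) :
    0 ≤ (u * a) % m + (u * b) % m - u % m ∧ (u * a) % m + (u * b) % m - u % m ≤ m := by
  have hm0 : 0 < m := by linarith [H.hm]
  set Y : ℕ → ℤ := fun i => (2 ^ i * u * a) % m + (2 ^ i * u * b) % m - (2 ^ i * u) % m with hY
  have hcop : ∀ i : ℕ, IsCoprime (2 ^ i * u) m := fun i => (cop_two_pow H.hodd i).mul_left hu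
  have hrec : ∀ i, Y (i + 1) = 2 * Y i - m * (hh m (2 ^ i * u * a) + hh m (2 ^ i * u * b) - hh m (2 ^ i * u)) := by
    intro i
    simp only [hY]
    have e1 : (2 : ℤ) ^ (i + 1) * u * a = 2 * (2 ^ i * u * a) := by ring
    have e2 : (2 : ℤ) ^ (i + 1) * u * b = 2 * (2 ^ i * u * b) := by ring
    have e3 : (2 : ℤ) ^ (i + 1) * u = 2 * (2 ^ i * u) := by ring
    rw [e1, e2, e3, emod_dbl hm0, emod_dbl hm0, emod_dbl hm0]
    ring
  have hbd : ∀ i, -m ≤ Y i ∧ Y i ≤ 2 * m := by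
    intro i
    have := emod_rg hm0 (2 ^ i * u * a)
    have := emod_rg hm0 (2 ^ i * u * b)
    have := emod_rg hm0 (2 ^ i * u)
    simp only [hY]
    omega
  have hg := growth (fun i => |2 * Y i - m|) m (3 * m) (fun i => by
    have h1 := hrec i
    have h2 := H.s12 _ (hcop i)
    have h3 : hh m (2 ^ i * u * a) + hh m (2 ^ i * u * b) - hh m (2 ^ i * u) = 0 ∨ hh m (2 ^ i * u * a) + hh m (2 ^ i * u * b) - hh m (2 ^ i * u) = 1 := by omega
    rcases h3 with h3 | h3 <;> rw [h3] at h1 <;> simp only [h1] <;>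
    rcases abs_cases (2 * Y i - m) with h4 | h4 <;> rw [h4.1]
    · have := le_abs_self (2 * (2 * Y i - m * 0) - m); linarith
    · have := neg_le_abs (2 * (2 * Y i - m * 0) - m); linarith
    · have := le_abs_self (2 * (2 * Y i - m * 1) - m); linarith
    · have := neg_le_abs (2 * (2 * Y i - m * 1) - m); linarith) (fun i => by
    have := hbd i
    rw [abs_le]; constructor <;> linarith)
  rw [abs_le] at hg
  simp only [hY, pow_zero, one_mul] at hg
  constructor <;> omega

lemma H2.main (H : H2 m a b c) {d : ℤ} (hd : m ∣ a + b - 1 - d) (hd0 : ¬ m ∣ d) (u : ℤ) (hu : IsCoprime u m) :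
    (u * a) % m + (u * b) % m = u % m + (u * d) % m ∧
    hh m (u * a) + hh m (u * b) = hh m u + hh m (u * d) ∧
    (hh m (u * d) = 0 → u % m + (u * d) % m < m) ∧
    (hh m (u * d) = 1 → m < u % m + (u * d) % m) := by
  have hm0 : 0 < m := by linarith [H.hm]
  have hodd := H.hodd
  have hY := H.Y u hu
  have hY2 := H.Y (2 * u) ((cop_two H.hodd).mul_left hu)
  obtain ⟨a0, a1, ka, ha⟩ := emod_rg hm0 (u * a)
  obtain ⟨b0, b1, kb, hb⟩ := emod_rg hm0 (u * b)
  obtain ⟨u0, u1, ku, hku⟩ := emod_rg hm0 u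
  obtain ⟨k, hk⟩ := hd
  have hne : (u * a) % m + (u * b) % m - u % m ≠ 0 ∧ (u * a) % m + (u * b) % m - u % m ≠ m := by
    constructor
    · intro h
      exact hd0 (unit_not_dvd hu ⟨ka + kb - ku - u * k, by linear_combination ha + hb - hku + h - u * hk⟩)
    · intro h
      exact hd0 (unit_not_dvd hu ⟨ka + kb - ku - u * k + 1, by linear_combination ha + hb - hku + h - u * hk⟩)
  have hr : (u * d) % m = (u * a) % m + (u * b) % m - u % m :=
    emod_uniq hY.1 (by omega) ⟨ku - ka - kb - u * k + u * 0 + 2 * ka + 2 * kb - 2 * ku, by linear_combination ha + hb - hku - u * hk⟩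
  have h1 : (u * a) % m + (u * b) % m = u % m + (u * d) % m := by linarith
  rw [mul_assoc, mul_assoc, emod_dbl hm0, emod_dbl hm0, emod_dbl hm0] at hY2
  have hs := H.s12 u hu
  have hS := H.S u hu
  obtain ⟨hY3, hY4⟩ := hY2
  have hq : hh m (u * a) + hh m (u * b) - hh m u = hh m (u * d) := by
    have h2 : hh m (u * a) + hh m (u * b) - hh m u = 0 ∨ hh m (u * a) + hh m (u * b) - hh m u = 1 := by omega
    have e : 2 * ((u * a) % m) - m * hh m (u * a) + (2 * ((u * b) % m) - m * hh m (u * b)) - (2 * (u % m) - m * hh m u) =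
      2 * ((u * d) % m) - m * (hh m (u * a) + hh m (u * b) - hh m u) := by rw [hr]; ring
    rw [e] at hY3 hY4
    rcases hh_cases m (u * d) with ⟨f, f'⟩ | ⟨f, f'⟩ <;> rcases h2 with h2 | h2 <;> rw [h2] at hY3 hY4 ⊢ <;> omega
  refine ⟨h1, by linarith, ?_, ?_⟩
  · intro h
    have e : 1 + hh m (u * a) + hh m (u * b) - hh m u = 1 := by omega
    rw [e] at hS
    omega
  · intro h
    have e : 1 + hh m (u * a) + hh m (u * b) - hh m u = 2 := by omega
    rw [e] at hS
    have := emod_rg hm0 (u * c)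
    omega
end


section
variable {m a b c : ℤ}

lemma H2.vA (H : H2 m a b c) {d : ℤ} (hd : m ∣ a + b - 1 - d) (hd0 : ¬ m ∣ d) {u x y : ℤ} (hu : IsCoprime u m)
    (x0 : 0 ≤ x) (x1 : x < m) (hx : m ∣ u - x) (y1 : y < m) (hy : m ∣ u * d - y)
    (h2 : m ≤ 2 * y) (h : x + y ≤ m) : False := by
  have h1 := H.main hd hd0 u hu
  have ex := emod_uniq x0 x1 hx
  have ey := emod_uniq (by omega) y1 hy
  rw [ex, ey] at h1
  rcases hh_cases m (u * d) with ⟨f, f'⟩ | ⟨f, f'⟩ <;> rw [ey] at f' <;> omega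

lemma H2.vB (H : H2 m a b c) {d : ℤ} (hd : m ∣ a + b - 1 - d) (hd0 : ¬ m ∣ d) {u x y : ℤ} (hu : IsCoprime u m)
    (x0 : 0 ≤ x) (x1 : x < m) (hx : m ∣ u - x) (y0 : 0 ≤ y) (hy : m ∣ u * d - y)
    (h2 : 2 * y < m) (h : m ≤ x + y) : False := by
  have h1 := H.main hd hd0 u hu
  have ex := emod_uniq x0 x1 hx
  have ey := emod_uniq y0 (by omega) hy
  rw [ex, ey] at h1
  rcases hh_cases m (u * d) with ⟨f, f'⟩ | ⟨f, f'⟩ <;> rw [ey] at f' <;> omega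

lemma H2.mod3 (H : H2 m a b c) (h3 : (3 : ℤ) ∣ m) :
    (a % 3 = 0 ∧ b % 3 = 0 ∧ c % 3 = 0 ∧ ¬ (9 : ℤ) ∣ m) ∨ (a % 3 = 1 ∧ b % 3 = 1 ∧ c % 3 = 1) ∨ (a % 3 = 2 ∧ b % 3 = 2 ∧ c % 3 = 2) := by
  have hT := h3.trans H.T
  have hs := h3.trans H.sum
  have e1 : (a * b + b * c + c * a + 3) % 3 = 0 := Int.emod_eq_zero_of_dvd hT
  have e2 : c % 3 = (-(a + b)) % 3 := emod_congr (by obtain ⟨k, hk⟩ := hs; exact ⟨k, by linarith⟩)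
  have ha : a % 3 = 0 ∨ a % 3 = 1 ∨ a % 3 = 2 := by omega
  have hb : b % 3 = 0 ∨ b % 3 = 1 ∨ b % 3 = 2 := by omega
  have hc : c % 3 = 0 ∨ c % 3 = 1 ∨ c % 3 = 2 := by omega
  by_cases h0 : a % 3 = 0 ∧ b % 3 = 0 ∧ c % 3 = 0
  · left
    refine ⟨h0.1, h0.2.1, h0.2.2, fun h9 => ?_⟩
    have hT9 := h9.trans H.T
    obtain ⟨a', rfl⟩ := Int.dvd_of_emod_eq_zero h0.1
    obtain ⟨b', rfl⟩ := Int.dvd_of_emod_eq_zero h0.2.1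
    obtain ⟨c', rfl⟩ := Int.dvd_of_emod_eq_zero h0.2.2
    obtain ⟨k, hk⟩ := hT9
    have : (9 : ℤ) ∣ 3 := ⟨k - a' * b' - b' * c' - c' * a', by linear_combination hk⟩
    omega
  · rcases ha with ha | ha | ha <;> rcases hb with hb | hb | hb <;> rcases hc with hc | hc | hc <;>
      first
      | omega
      | (exfalso; simp [Int.add_emod, Int.mul_emod, ha, hb, hc] at e1)

lemma H2.big (H : H2 m a b c) {D P : ℤ} (hd : m ∣ a + b - 1 - D) (hD : 2 ≤ D)
    (hP : IsCoprime P m) (hP1 : 1 ≤ P) (h1 : 4 * (P * D) < m) (h2 : m < 4 * (P * D) + 4 * P) : False := by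
  have hm := H.hm
  have hm0 : 0 < m := by omega
  have hPD : D ≤ P * D := by nlinarith
  have hDm : D < m := by omega
  have hd0 : ¬ m ∣ D := fun h => by have := Int.le_of_dvd (by omega) h; omega
  have hT := H.T
  have hs := H.sum
  -- first exclude small `D`
  have hD4 : 4 ≤ D := by
    have e := (H.main hd hd0 1 isCoprime_one_left).1
    simp only [one_mul] at e
    rw [Int.emod_eq_of_lt (by omega) (by omega : (1 : ℤ) < m), Int.emod_eq_of_lt (by omega) hDm] at e
    obtain ⟨a0, a1, ka, hka⟩ := emod_rg hm0 a
    obtain ⟨b0, b1, kb, hkb⟩ := emod_rg hm0 b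
    generalize hα : a % m = α at *
    generalize hβ : b % m = β at *
    have key : m ∣ α * β - (1 + D) ^ 2 + 3 := by
      obtain ⟨t, ht⟩ := hT
      obtain ⟨s, hs⟩ := hs
      obtain ⟨q, hq⟩ := hd
      have ea : a = α + m * ka := by linarith
      have eb : b = β + m * kb := by linarith
      have ec : c = m * s - a - b := by linarith
      have eD : D = α + β - 1 := by linarith
      rw [eD]
      subst ec
      subst ea
      subst eb
      refine ⟨t - α * kb - β * ka - m * ka * kb - s * (α + m * ka + β + m * kb) + 2 * (α + β) * (ka + kb) + m * (ka + kb) ^ 2, ?_⟩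
      linear_combination ht
    by_contra hlt
    push Not at hlt
    have hbeta : β = 1 + D - α := by linarith
    have hαb : α ≤ 4 := by omega
    subst hbeta
    have kk := (dvd_neg).2 key
    interval_cases D <;> interval_cases α <;>
      first
      | omega
      | (have := Int.le_of_dvd (by norm_num) kk; omega)
  have hX : 4 * P ≤ P * D := by nlinarith
  by_cases h3 : (3 : ℤ) ∣ m
  swap
  · have h3' : IsCoprime (3 : ℤ) m := by
      rw [Prime.coprime_iff_not_dvd (by norm_num)]; exact h3
    refine H.vA hd hd0 (u := 3 * P) (x := 3 * P) (y := 3 * (P * D)) (h3'.mul_left hP) ?_ ?_ ⟨0, by ring⟩ ?_ ⟨0, by ring⟩ ?_ ?_ <;> omega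
  have hP3 : ¬ (3 : ℤ) ∣ P := cop_not_dvd hP h3 (by norm_num)
  rcases H.mod3 h3 with ⟨a3, b3, c3, h9⟩ | ⟨a3, b3, c3⟩ | ⟨a3, b3, c3⟩
  all_goals obtain ⟨N, hN⟩ := h3
  · refine three_contra (m := m) (N := N) hN H.hodd (by omega) (by omega) ?_
    intro u u' hu hu' hdv
    have e1 := H.S u hu
    have e2 := H.S u' hu'
    have cg : ∀ x : ℤ, x % 3 = 0 → m ∣ u * x - u' * x := by
      intro x hx
      obtain ⟨x', rfl⟩ := Int.dvd_of_emod_eq_zero hx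
      obtain ⟨k, hk⟩ := hdv
      exact ⟨k * x', by rw [hN]; linear_combination 3 * x' * hk⟩
    rw [emod_congr (cg a a3), emod_congr (cg b b3), emod_congr (cg c c3), hh_congr (cg a a3), hh_congr (cg b b3), e2] at e1
    have := mul_left_cancel₀ hm0.ne' e1
    linarith
  · have hD3 : ∃ k, D = 3 * k + 1 := by
      obtain ⟨k, hk⟩ := (Dvd.intro N hN.symm : (3 : ℤ) ∣ m).trans hd
      exact ⟨(D - 1) / 3, by omega⟩
    obtain ⟨k, hk⟩ := hD3
    by_cases h9 : (9 : ℤ) ∣ m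
    · refine H.vA hd hd0 (u := P + 1 * N) (x := P + N) (y := P * D + N) (unit_of (p := 3) (by norm_num) (by exact_mod_cast hN) hm0.ne' hP (by push_cast; omega)) ?_ ?_ ⟨0, by ring⟩ ?_ ⟨k, ?_⟩ ?_ ?_
      all_goals try omega
      · rw [hN]; linear_combination N * hk
    · have hc : IsCoprime (3 * P + 2 * N) m := by
        have c1 : IsCoprime P N := hP.of_isCoprime_of_dvd_right ⟨3, by linarith⟩
        have c2 : IsCoprime (2 : ℤ) 3 := ⟨-1, 1, by norm_num⟩
        have c3 : IsCoprime (3 : ℤ) N := by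
          rw [Prime.coprime_iff_not_dvd (by norm_num)]; omega
        rw [hN]
        apply IsCoprime.mul_right
        · exact cop_congr (x := 2 * N) ⟨-P, by ring⟩ (c2.mul_left c3.symm)
        · exact cop_congr (x := 3 * P) ⟨-2, by ring⟩ (c3.mul_left c1)
      refine H.vB hd hd0 (x := 3 * P + 2 * N) (y := 3 * (P * D) + 2 * N - m) hc ?_ ?_ ⟨0, by ring⟩ ?_ ⟨2 * k + 1, ?_⟩ ?_ ?_
      all_goals try omega
      · linear_combination 2 * N * hk - 2 * k * hN
  · have hD3 : ∃ k, D = 3 * k := by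
      obtain ⟨k, hk⟩ := (Dvd.intro N hN.symm : (3 : ℤ) ∣ m).trans hd
      exact ⟨D / 3, by omega⟩
    obtain ⟨k, hk⟩ := hD3
    have hX6 : 6 * P ≤ P * D := by
      have : 6 ≤ D := by omega
      nlinarith
    by_cases h9 : (9 : ℤ) ∣ m
    · refine H.vB hd hd0 (u := 2 * P + 2 * N) (x := 2 * P + 2 * N) (y := 2 * (P * D)) (unit_of (p := 3) (by norm_num) (by exact_mod_cast hN) hm0.ne' ((cop_two H.hodd).mul_left hP) (by push_cast; omega)) ?_ ?_ ⟨0, by ring⟩ ?_ ⟨2 * k, ?_⟩ ?_ ?_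
      all_goals try omega
      · rw [hN]; linear_combination 2 * N * hk
    · have hc : IsCoprime (6 * P + 2 * N) m := by
        have c1 : IsCoprime P N := hP.of_isCoprime_of_dvd_right ⟨3, by linarith⟩
        have c2 : IsCoprime (2 : ℤ) 3 := ⟨-1, 1, by norm_num⟩
        have c3 : IsCoprime (3 : ℤ) N := by
          rw [Prime.coprime_iff_not_dvd (by norm_num)]; omega
        have c4 : IsCoprime (2 : ℤ) N := (cop_two H.hodd).of_isCoprime_of_dvd_right ⟨3, by linarith⟩
        rw [hN]
        apply IsCoprime.mul_right
        · exact cop_congr (x := 2 * N) ⟨-2 * P, by ring⟩ (c2.mul_left c3.symm)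
        · exact cop_congr (x := 2 * (3 * P)) ⟨-2, by ring⟩ (c4.mul_left (c3.mul_left c1))
      refine H.vB hd hd0 (x := 6 * P + 2 * N) (y := 6 * (P * D) - m) hc ?_ ?_ ⟨0, by ring⟩ ?_ ⟨2 * k + 1, ?_⟩ ?_ ?_
      all_goals try omega
      · linear_combination 2 * N * hk - 2 * k * hN
end


section
variable {m a b c : ℤ}

/-- `2d ≡ -1`: basic congruences -/
lemma H2.half_cong (H : H2 m a b c) {D : ℤ} (hd : m ∣ a + b - 1 - D) (hD : m = 2 * D + 1) :
    m ∣ 2 * a + 2 * b - 1 ∧ m ∣ 4 * a * b + 11 := by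
  obtain ⟨k, hk⟩ := hd
  obtain ⟨t, ht⟩ := H.T
  obtain ⟨s, hs⟩ := H.sum
  have e1 : 2 * a + 2 * b - 1 = m * (2 * k + 1) := by linear_combination 2 * hk - hD
  refine ⟨⟨2 * k + 1, e1⟩, ⟨4 * t - 4 * s * (a + b) + (2 * k + 1) * (2 * a + 2 * b + 1), ?_⟩⟩
  linear_combination 4 * ht - 4 * (a + b) * hs + (2 * a + 2 * b + 1) * e1

lemma H2.half_key (H : H2 m a b c) {D : ℤ} (hd : m ∣ a + b - 1 - D) (hD : m = 2 * D + 1) (hb : IsCoprime b m)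
    {v : ℤ} (hv : IsCoprime v m) (h11 : m ∣ 11 * v - 11) :
    2 * ((v * (2 * b)) % m) < m ∨ m - 11 ≤ (v * (2 * b)) % m := by
  have hm := H.hm
  have hm0 : 0 < m := by omega
  have hd0 : ¬ m ∣ D := fun h => by have := Int.le_of_dvd (by omega) h; omega
  have c2 := cop_two H.hodd
  have hx : IsCoprime (v * (2 * b)) m := hv.mul_left (c2.mul_left hb)
  obtain ⟨⟨p, hp⟩, ⟨q, hq⟩⟩ := H.half_cong hd hD
  obtain ⟨r, hr⟩ := h11
  have h := (H.main hd hd0 (2 * (v * (2 * b))) (c2.mul_left hx)).2.1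
  have e1 : hh m (2 * (v * (2 * b)) * a) = hh m (m - 11) := hh_congr ⟨v * q - r - 1, by linear_combination v * hq - hr⟩
  have e2 : hh m (2 * (v * (2 * b)) * b) = hh m (v * (2 * b) + 11) :=
    hh_congr ⟨2 * v * b * p - v * q + r, by linear_combination 2 * v * b * hp - v * hq + hr⟩
  have e3 : hh m (2 * (v * (2 * b)) * D) = hh m (-(v * (2 * b))) :=
    hh_congr ⟨v * (2 * b), by linear_combination -(v * (2 * b)) * hD⟩
  have hnd : ¬ m ∣ v * (2 * b) := cop_not_dvd hx dvd_rfl (by omega)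
  rw [e1, e2, e3, hh_hi (by omega) (by omega)] at h
  have e4 := emod_negg hm0 hnd
  have e5 := emod_dbl hm0 (v * (2 * b))
  obtain ⟨x0, x1, kx, hkx⟩ := emod_rg hm0 (v * (2 * b))
  generalize v * (2 * b) = X at *
  by_contra hcon
  push Not at hcon
  have e6 : (X + 11) % m = X % m + 11 := emod_uniq (by omega) (by omega) ⟨kx, by linarith⟩
  have f1 := hh_cases m (X + 11)
  have f2 := hh_cases m (-X)
  have f3 := hh_bd m (2 * X)
  rw [e6] at f1
  rw [e4] at f2
  have hodd := H.hodd
  omega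

lemma H2.half_unit (H : H2 m a b c) {D : ℤ} (hd : m ∣ a + b - 1 - D) (hD : m = 2 * D + 1) (hb : ¬ IsCoprime b m) :
    (11 : ℤ) ∣ m ∧ (11 : ℤ) ∣ b := by
  have hm := H.hm
  obtain ⟨p, hp, hpm, hpb⟩ := exists_prime_of_not_cop hb (by omega)
  have h := hpm.trans (H.half_cong hd hD).2
  have h11 : (p : ℤ) ∣ 11 := by
    have := (dvd_add_right (hpb.mul_left (4 * a))).1 h
    exact this
  have : p ∣ 11 := by exact_mod_cast h11
  have : p = 11 := ((Nat.dvd_prime (by norm_num)).1 this).resolve_left hp.one_lt.ne'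
  subst this
  exact ⟨by exact_mod_cast hpm, by exact_mod_cast hpb⟩

lemma H2.half_one (H : H2 m a b c) {D : ℤ} (hd : m ∣ a + b - 1 - D) (hD : m = 2 * D + 1) (hb : IsCoprime b m)
    (ha : (11 : ℤ) ∣ a) (h11 : (11 : ℤ) ∣ m) : False := by
  have hm := H.hm
  have hm0 : 0 < m := by omega
  have h2b : (11 : ℤ) ∣ 2 * b - 1 := by
    have := h11.trans (H.half_cong hd hD).1
    omega
  obtain ⟨N, hN⟩ := h11
  have key : ∀ k, IsCoprime (1 + k * N) m → ∀ σ, 0 ≤ σ → σ < m → m ∣ 2 * b + k * N - σ → 2 * σ < m ∨ m - 11 ≤ σ := by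
    intro k hk σ h0 h1 h2
    have h := H.half_key hd hD hb hk ⟨k, by rw [hN]; ring⟩
    have e : ((1 + k * N) * (2 * b)) % m = σ := emod_uniq h0 h1 (by
      obtain ⟨t, ht⟩ := h2
      obtain ⟨s, hs⟩ := h2b
      exact ⟨t + k * s, by linear_combination ht + k * N * hs - k * s * hN⟩)
    rwa [e] at h
  have sh := fun k1 k2 h h' => unit_shift (p := 11) (by norm_num) (n := m) (N := N) (by exact_mod_cast hN) hm0.ne' (isCoprime_one_left : IsCoprime 1 m) k1 k2 h h'
  obtain ⟨r0, r1, q, hq⟩ := emod_rg hm0 (2 * b)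
  have h0 := key 0 (by simpa using isCoprime_one_left) _ r0 r1 ⟨q, by linarith⟩
  generalize (2 * b) % m = ρ at *
  rcases h0 with h0 | h0
  · have hNp : 0 < N := by omega
    have g1 := Int.emod_add_mul_ediv ρ N
    have g2 := emod_rg hNp ρ
    have g3 : 0 ≤ N * (ρ / N) := by
      apply mul_nonneg hNp.le; exact Int.ediv_nonneg r0 hNp.le
    generalize ρ / N = g at *
    rcases sh (6 - g) (7 - g) (by omega) (by norm_num) with hu | hu
    · have := key _ hu (ρ % N + 6 * N) (by omega) (by omega) ⟨q, by linear_combination hq - g1⟩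
      omega
    · have := key _ hu (ρ % N + 7 * N) (by omega) (by omega) ⟨q, by linear_combination hq - g1⟩
      omega
  · rcases sh (-4) (-3) (by omega) (by norm_num) with hu | hu
    · have := key _ hu (ρ - 4 * N) (by omega) (by omega) ⟨q, by linear_combination hq⟩
      omega
    · have := key _ hu (ρ - 3 * N) (by omega) (by omega) ⟨q, by linear_combination hq⟩
      omega

lemma H2.half_t (H : H2 m a b c) {D : ℤ} (hd : m ∣ a + b - 1 - D) (hD : m = 2 * D + 1) (h11 : ¬ (11 : ℤ) ∣ m)
    (hb : m - 11 ≤ (2 * b) % m) : False := by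
  have hm := H.hm
  have hm0 : 0 < m := by omega
  obtain ⟨⟨p, hp⟩, ⟨q, hq⟩⟩ := H.half_cong hd hD
  obtain ⟨r0, r1, k, hk⟩ := emod_rg hm0 (2 * b)
  obtain ⟨t, ht⟩ : ∃ t, t = m - (2 * b) % m := ⟨_, rfl⟩
  have e : m ∣ t ^ 2 + t - 11 := by
    have : t = m - 2 * b + m * k := by linarith
    rw [this]
    refine ⟨(1 + k) * (m * (1 + k) - 4 * b + 1) + 2 * b * p - q, ?_⟩
    linear_combination 2 * b * hp - hq
  have t1 : 1 ≤ t := by omega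
  have t2 : t ≤ 11 := by omega
  have aux : ∀ x : ℤ, m ∣ x → x ≠ 0 → m ≤ |x| := fun x h hx => Int.le_of_dvd (abs_pos.2 hx) ((dvd_abs _ _).2 h)
  clear ht
  interval_cases t <;> norm_num at e <;> try (have := aux _ e (by norm_num); norm_num at this; omega)
  all_goals
    obtain ⟨s, hs⟩ := e
    have s1 : 0 < s := by by_contra h; push Not at h; nlinarith
    have s2 : s < 2 := by by_contra h; push Not at h; nlinarith
    have : s = 1 := by omega
    subst this
    omega

lemma H2.half (H : H2 m a b c) {D : ℤ} (hd : m ∣ a + b - 1 - D) (hD : m = 2 * D + 1) : False := by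
  have hm := H.hm
  have hm0 : 0 < m := by omega
  have hd' : m ∣ b + a - 1 - D := by rwa [add_comm b a]
  obtain ⟨h1, h2⟩ := H.half_cong hd hD
  by_cases hb : IsCoprime b m
  · by_cases ha : IsCoprime a m
    · have h11 : ¬ (11 : ℤ) ∣ m := by
        intro h
        have h3 := h.trans h2
        have na := cop_not_dvd ha h (by norm_num)
        have nb := cop_not_dvd hb h (by norm_num)
        have : (11 : ℤ) ∣ 4 * a * b := by omega
        have p11 : Prime (11 : ℤ) := by norm_num
        rcases p11.dvd_or_dvd this with h | h
        · rcases p11.dvd_or_dvd h with h | h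
          · omega
          · exact na h
        · exact nb h
      have kb := H.half_key hd hD hb isCoprime_one_left ⟨0, by ring⟩
      have ka := H.swap.half_key hd' hD ha isCoprime_one_left ⟨0, by ring⟩
      rw [one_mul] at ka kb
      have ka' : 2 * ((2 * a) % m) < m := ka.resolve_right (fun h => H.swap.half_t hd' hD h11 h)
      have kb' : 2 * ((2 * b) % m) < m := kb.resolve_right (fun h => H.half_t hd hD h11 h)
      have c2 := cop_two H.hodd
      have za := emod_ne_zero (cop_not_dvd (c2.mul_left ha) dvd_rfl (by omega))
      have zb := emod_ne_zero (cop_not_dvd (c2.mul_left hb) dvd_rfl (by omega))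
      obtain ⟨a0, a1, k, hk⟩ := emod_rg hm0 (2 * a)
      obtain ⟨b0, b1, l, hl⟩ := emod_rg hm0 (2 * b)
      obtain ⟨s, hs⟩ := h1
      have : (2 * a) % m + (2 * b) % m - 1 = 0 := by
        apply Int.eq_zero_of_dvd_of_nonneg_of_lt (by omega) (by omega : _ < m)
        exact ⟨s - k - l, by linear_combination hs - hk - hl⟩
      omega
    · obtain ⟨u, v⟩ := H.swap.half_unit hd' hD ha
      exact H.half_one hd hD hb v u
  · obtain ⟨u, v⟩ := H.half_unit hd hD hb
    have ha : IsCoprime a m := by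
      by_contra ha
      obtain ⟨_, w⟩ := H.swap.half_unit hd' hD ha
      have := u.trans h1
      omega
    exact H.swap.half_one hd' hD ha v u

/-- the case `d ≢ 0` -/
lemma H2.d_one (H : H2 m a b c) {D : ℤ} (hd : m ∣ a + b - 1 - D) (h0 : 0 < D) (h1 : D < m) : D = 1 := by
  have hm := H.hm
  have hm0 : 0 < m := by omega
  have hodd := H.hodd
  have hd0 : ¬ m ∣ D := fun h => by have := Int.le_of_dvd (by omega) h; omega
  by_contra hD1
  have hl : 2 * D < m := by
    by_contra hl
    exact H.vA hd hd0 (u := 1) (x := 1) (y := D) isCoprime_one_left (by omega) (by omega) ⟨0, by ring⟩ h1 ⟨0, by ring⟩ (by omega) (by omega)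
  have hq1 : 1 ≤ (m - 1) / D := by
    rw [Int.le_ediv_iff_mul_le h0]; omega
  obtain ⟨I, hI, hI'⟩ := pow_between hq1
  rw [Int.le_ediv_iff_mul_le h0] at hI
  rw [Int.ediv_lt_iff_lt_mul h0] at hI'
  have hI2 : m < 2 ^ (I + 1) * D := by
    rcases (show m ≤ 2 ^ (I + 1) * D by omega).lt_or_eq with h | h
    · exact h
    · rw [pow_succ] at h
      have : m = 2 * (2 ^ I * D) := by rw [h]; ring
      omega
  have hpos : (1 : ℤ) ≤ 2 ^ I := one_le_pow₀ (by norm_num)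
  have e1 : (2 : ℤ) ^ (I + 1) * D = 2 * (2 ^ I * D) := by ring
  rw [e1] at hI2
  have hle : (2 : ℤ) ^ I ≤ 2 ^ I * D := by nlinarith
  have h3 : m < 2 ^ I + 2 ^ I * D := by
    by_contra h
    exact H.vA hd hd0 (u := 2 ^ I) (x := 2 ^ I) (y := 2 ^ I * D) (cop_two_pow hodd I) (by omega) (by omega) ⟨0, by ring⟩ (by omega) ⟨0, by ring⟩ (by omega) (by omega)
  match I, hI, hI2, hpos, hle, h3 with
  | 0, hI, hI2, _, _, h3 => simp at hI2 h3; omega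
  | 1, hI, hI2, _, _, h3 => exact H.half hd (by simp at hI2 h3; omega)
  | J + 2, hI, hI2, _, _, h3 =>
    have e2 : (2 : ℤ) ^ (J + 2) = 4 * 2 ^ J := by ring
    rw [e2, mul_assoc] at hI h3
    exact H.big hd (by omega) (cop_two_pow hodd J) (one_le_pow₀ (by norm_num)) (by omega) (by omega)
end


structure H3 (m a : ℤ) : Prop where
  hm : 80 < m
  hodd : m % 2 = 1
  T : m ∣ (a + 1) * (a - 2)
  V1 : ∀ u x y, IsCoprime u m → m ∣ u - x → m ∣ u * a - y → 0 ≤ x → 2 * x < m → m < 2 * y → y < m →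
    2 * (y - x) < m → False
  V2 : ∀ u x y, IsCoprime u m → m ∣ u - x → m ∣ u * a - y → 0 ≤ y → 2 * y < m → m < 2 * x → x < m →
    2 * (x - y) < m → False
  W1 : ∀ u x y, IsCoprime u m → m ∣ u - x → m ∣ u * (1 - a) - y → 0 ≤ x → 2 * x < m → m < 2 * y → y < m →
    2 * (y - x) < m → False
  W2 : ∀ u x y, IsCoprime u m → m ∣ u - x → m ∣ u * (1 - a) - y → 0 ≤ y → 2 * y < m → m < 2 * x → x < m →
    2 * (x - y) < m → False

lemma H3.swap {m a : ℤ} (H : H3 m a) : H3 m (1 - a) where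
  hm := H.hm
  hodd := H.hodd
  T := by have := H.T; ring_nf at this ⊢; exact this
  V1 := H.W1
  V2 := H.W2
  W1 := by rw [sub_sub_cancel]; exact H.V1
  W2 := by rw [sub_sub_cancel]; exact H.V2

lemma H2.V12 {m a b c : ℤ} (H : H2 m a b c) (hd : m ∣ a + b - 1) {u x y : ℤ} (hu : IsCoprime u m)
    (hx : m ∣ u - x) (hy : m ∣ u * a - y) (x0 : 0 ≤ x) (y0 : 0 ≤ y) (x1 : x < m) (y1 : y < m) :
    ¬ (2 * x < m ∧ m < 2 * y ∧ 2 * (y - x) < m) ∧ ¬ (2 * y < m ∧ m < 2 * x ∧ 2 * (x - y) < m) := by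
  have hm := H.hm
  have hm0 : 0 < m := by omega
  have hS := H.S u hu
  have hs := H.s12 u hu
  have ex := emod_uniq x0 x1 hx
  have ey := emod_uniq y0 y1 hy
  have hx0 : ¬ m ∣ u := cop_not_dvd hu dvd_rfl (by omega)
  have ec : (u * c) % m = m - x := by
    rw [← ex, ← emod_negg hm0 hx0]
    obtain ⟨k, hk⟩ := hd
    obtain ⟨l, hl⟩ := H.sum
    exact emod_congr ⟨u * (l - k), by linear_combination u * (hl - hk)⟩
  rw [ec, ey] at hS
  have f1 := hh_cases m u
  have f2 := hh_cases m (u * a)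
  have f3 := hh_cases m (u * b)
  rw [ex] at f1
  rw [ey] at f2
  have gb := emod_rg hm0 (u * b)
  obtain ⟨s1, s2, _⟩ := hs
  have hs : 1 + hh m (u * a) + hh m (u * b) - hh m u = 1 ∨ 1 + hh m (u * a) + hh m (u * b) - hh m u = 2 := by omega
  rcases hs with h | h <;> rw [h] at hS <;> omega

lemma H2.toH3 {m a b c : ℤ} (H : H2 m a b c) (hd : m ∣ a + b - 1) : H3 m a := by
  have hd' : m ∣ b + a - 1 := by rwa [add_comm b a]
  have cg : ∀ u y, m ∣ u * (1 - a) - y → m ∣ u * b - y := by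
    intro u y h
    obtain ⟨k, hk⟩ := hd
    obtain ⟨l, hl⟩ := h
    exact ⟨l + u * k, by linear_combination hl + u * hk⟩
  refine ⟨H.hm, H.hodd, ?_, ?_, ?_, ?_, ?_⟩
  · obtain ⟨k, hk⟩ := hd
    obtain ⟨t, ht⟩ := H.T
    obtain ⟨s, hs⟩ := H.sum
    exact ⟨-t + s * (a + b) - k * b - k, by linear_combination -ht + (a + b) * hs - (b + 1) * hk⟩
  · intro u x y hu hx hy h1 h2 h3 h4 h5
    exact (H.V12 hd hu hx hy (by omega) (by omega) (by omega) (by omega)).1 ⟨h2, h3, h5⟩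
  · intro u x y hu hx hy h1 h2 h3 h4 h5
    exact (H.V12 hd hu hx hy (by omega) (by omega) (by omega) (by omega)).2 ⟨h2, h3, h5⟩
  · intro u x y hu hx hy h1 h2 h3 h4 h5
    exact (H.swap.V12 hd' hu hx (cg _ _ hy) (by omega) (by omega) (by omega) (by omega)).1 ⟨h2, h3, h5⟩
  · intro u x y hu hx hy h1 h2 h3 h4 h5
    exact (H.swap.V12 hd' hu hx (cg _ _ hy) (by omega) (by omega) (by omega) (by omega)).2 ⟨h2, h3, h5⟩

def v3 (m a u : ℕ) : Bool :=
  (Nat.ble (2 * u + 1) m && Nat.ble (m + 1) (2 * ((u * a) % m)) && Nat.ble (2 * ((u * a) % m) + 1) (m + 2 * u)) &&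
    Nat.beq (Nat.gcd u m) 1

def b3 (m : ℕ) : Bool :=
  allB m (fun a => bif Nat.beq (((a + 1) * (a + m - 2)) % m) 0 then anyB m (v3 m a) else true)

set_option maxRecDepth 100000 in
lemma b3_all : allB 177 (fun i => b3 (2 * i + 81)) = true := by decide +kernel

lemma H3.small {m a : ℤ} (H : H3 m a) (h : m ≤ 432) : False := by
  have hm := H.hm
  have hm0 : 0 < m := by omega
  have hodd := H.hodd
  obtain ⟨a0, a1, k, hk⟩ := emod_rg hm0 a
  obtain ⟨A, hA⟩ : ∃ A : ℕ, a % m = (A : ℤ) := ⟨(a % m).toNat, by omega⟩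
  rw [hA] at a0 a1 hk
  obtain ⟨i, hi⟩ : ∃ i : ℕ, m = ((2 * i + 81 : ℕ) : ℤ) := ⟨((m - 81) / 2).toNat, by omega⟩
  have h1 := allB_spec b3_all i (by omega)
  have h2 := allB_spec h1 A (by omega)
  have hT : Nat.beq (((A + 1) * (A + (2 * i + 81) - 2)) % (2 * i + 81)) 0 = true := by
    rw [Nat.beq_eq]
    apply Nat.mod_eq_zero_of_dvd
    have e : ((A + (2 * i + 81) - 2 : ℕ) : ℤ) = A + m - 2 := by omega
    zify
    have e' : (2 * (i : ℤ) + 81) = m := by rw [hi]; push_cast; ring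
    rw [e, e']
    obtain ⟨t, ht⟩ := H.T
    have ea : a = A + m * k := by linarith
    rw [ea] at ht
    exact ⟨t + A + 1 - 2 * k * A + k - m * k ^ 2, by linear_combination ht⟩
  rw [hT] at h2
  simp only [cond_true] at h2
  obtain ⟨u, hu, hv⟩ := anyB_spec h2
  simp only [v3, Bool.and_eq_true, Nat.beq_eq, Nat.ble_eq] at hv
  obtain ⟨⟨⟨v1, v2⟩, v3⟩, v4⟩ := hv
  have hc : IsCoprime (u : ℤ) m := by
    rw [hi]
    exact Nat.isCoprime_iff_coprime.2 (by simpa using v4)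
  have hlt : (u * A) % (2 * i + 81) < 2 * i + 81 := Nat.mod_lt _ (by omega)
  refine H.V1 u u (((u * A) % (2 * i + 81) : ℕ) : ℤ) hc ⟨0, by ring⟩ ?_ (by omega) (by omega) (by omega) (by omega) (by omega)
  have e2 : (((u * A) % (2 * i + 81) : ℕ) : ℤ) = ((u : ℤ) * A) % m := by
    rw [hi]; push_cast; rfl
  rw [e2]
  obtain ⟨_, _, l, hl⟩ := emod_rg hm0 ((u : ℤ) * A)
  exact ⟨l + u * k, by linear_combination hl + u * hk⟩


lemma unit_lift {x E m : ℤ} (hE : 0 < E) (hm : 0 < m) (hEm : E ∣ m) (hx : IsCoprime x E) :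
    ∃ u, IsCoprime u m ∧ E ∣ u - x := by
  obtain ⟨r0, r1, hr⟩ := emod_rg hE x
  have hr' := cop_congr hr hx
  lift E to ℕ using hE.le
  lift m to ℕ using hm.le
  obtain ⟨y, hy⟩ : ∃ y : ℕ, x % (E : ℤ) = y := ⟨(x % (E : ℤ)).toNat, by omega⟩
  rw [hy] at hr hr'
  have hyc : Nat.Coprime y E := Nat.isCoprime_iff_coprime.1 hr'
  have hd : E ∣ m := by exact_mod_cast hEm
  have : NeZero m := ⟨by omega⟩
  have : NeZero E := ⟨by omega⟩
  obtain ⟨w, hw⟩ := ZMod.unitsMap_surjective hd (ZMod.unitOfCoprime y hyc)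
  refine ⟨((w : ZMod m).val : ℕ), Nat.isCoprime_iff_coprime.2 (ZMod.val_coe_unit_coprime w), ?_⟩
  have h1 : (((w : ZMod m).val : ℕ) : ZMod E) = (y : ZMod E) := by
    have h2 := congrArg (fun z : (ZMod E)ˣ => (z : ZMod E)) hw
    simp only [ZMod.coe_unitOfCoprime, ZMod.unitsMap_val] at h2
    rw [← h2]
    simp [ZMod.natCast_val]
  have h3 : (E : ℤ) ∣ (((w : ZMod m).val : ℕ) : ℤ) - y := by
    have := (ZMod.natCast_eq_natCast_iff _ _ _).1 h1
    have h4 := (Nat.modEq_iff_dvd.1 this)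
    obtain ⟨k, hk⟩ := h4
    exact ⟨-k, by linarith⟩
  obtain ⟨k, hk⟩ := h3
  obtain ⟨l, hl⟩ := hr
  exact ⟨k - l, by linear_combination hk - hl⟩

lemma H3.decomp {m a : ℤ} (H : H3 m a) : ∃ D E A, m = D * E ∧ a + 1 = D * A ∧ IsCoprime A E ∧ 0 < D ∧ 0 < E ∧ E ∣ a - 2 := by
  have hm := H.hm
  have hm0 : 0 < m := by omega
  have hg : 0 < Int.gcd (a + 1) m := Int.gcd_pos_of_ne_zero_right _ hm0.ne'
  obtain ⟨A, hA⟩ := Int.gcd_dvd_left (a + 1) m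
  obtain ⟨E, hE⟩ := Int.gcd_dvd_right (a + 1) m
  have hg' : (0 : ℤ) < (Int.gcd (a + 1) m : ℤ) := by exact_mod_cast hg
  have hcop : IsCoprime A E := by
    have hb := Int.gcd_eq_gcd_ab (a + 1) m
    refine ⟨Int.gcdA (a + 1) m, Int.gcdB (a + 1) m, ?_⟩
    generalize Int.gcdA (a + 1) m = p at *
    generalize Int.gcdB (a + 1) m = q at *
    generalize hG : (Int.gcd (a + 1) m : ℤ) = G at *
    apply mul_left_cancel₀ hg'.ne'
    linear_combination -hb - p * hA - q * hE
  generalize (Int.gcd (a + 1) m : ℤ) = G at *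
  have hE0 : 0 < E := by
    by_contra h; push Not at h; nlinarith
  refine ⟨G, E, A, hE, hA, hcop, hg', hE0, ?_⟩
  have hT := H.T
  rw [hE, hA, mul_assoc] at hT
  exact hcop.symm.dvd_of_dvd_mul_left (Int.dvd_of_mul_dvd_mul_left hg'.ne' hT)

lemma H3.nine {m a : ℤ} (H : H3 m a) (h9 : (9 : ℤ) ∣ m) (ha : (3 : ℤ) ∣ a + 1) {u z : ℤ} (hu : IsCoprime u m)
    (hz : m ∣ u * (a + 1) - z) (z0 : 0 ≤ z) (z1 : 12 * z < m) : False := by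
  have hm := H.hm
  have hm0 : 0 < m := by omega
  have hodd := H.hodd
  obtain ⟨N', hN'⟩ := h9
  obtain ⟨N, hN⟩ : ∃ N, N = 3 * N' := ⟨_, rfl⟩
  have hmN : m = 3 * N := by omega
  have sh : ∀ w k : ℤ, IsCoprime w m → IsCoprime (w + k * N) m := by
    intro w k hw
    refine unit_of (p := 3) (by norm_num) (by exact_mod_cast hmN) hm0.ne' hw ?_
    have h3 := cop_not_dvd hw ⟨N, hmN⟩ (by norm_num : (1 : ℤ) < 3)
    rw [hN]
    intro h
    apply h3
    obtain ⟨t, ht⟩ := h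
    exact ⟨t - k * N', by push_cast at ht; linear_combination ht⟩
  have shz : ∀ w k z : ℤ, m ∣ w * (a + 1) - z → m ∣ (w + k * N) * (a + 1) - z := by
    intro w k z h
    obtain ⟨t, ht⟩ := h
    obtain ⟨s, hs⟩ := ha
    exact ⟨t + k * s, by linear_combination ht + k * N * hs - k * s * hmN⟩
  -- violation criteria
  have c1 : ∀ w x z : ℤ, IsCoprime w m → m ∣ w - x → m ∣ w * (a + 1) - z → 0 ≤ z → 6 * z < m → m + 2 * z < 4 * x → 2 * x < m → False := by
    intro w x z hw hx hz z0 z1 h1 h2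
    refine H.V1 w x (z - x + m) hw hx ?_ (by omega) h2 (by omega) (by omega) (by omega)
    obtain ⟨t, ht⟩ := hx
    obtain ⟨s, hs⟩ := hz
    exact ⟨s - t - 1, by linear_combination hs - ht⟩
  have c2 : ∀ w x z : ℤ, IsCoprime w m → m ∣ w - x → m ∣ w * (a + 1) - z → 0 ≤ z → 6 * z < m → m + 2 * z < 2 * x → 4 * x < 3 * m + 2 * z → False := by
    intro w x z hw hx hz z0 z1 h1 h2
    refine H.V2 w x (z - x + m) hw hx ?_ (by omega) (by omega) (by omega) (by omega) (by omega)
    obtain ⟨t, ht⟩ := hx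
    obtain ⟨s, hs⟩ := hz
    exact ⟨s - t - 1, by linear_combination hs - ht⟩
  have mid : ∀ w x : ℤ, IsCoprime w m → m ∣ w - x → m ∣ w * (a + 1) - z → m + 2 * z < 4 * x → 4 * x < 3 * m + 2 * z → False := by
    intro w x hw hx hz h1 h2
    by_cases h3 : 2 * x < m
    · exact c1 w x z hw hx hz z0 (by omega) h1 h3
    by_cases h4 : m + 2 * z < 2 * x
    · exact c2 w x z hw hx hz z0 (by omega) h4 h2
    refine c1 (2 * w + 1 * N) (2 * x - m + N) (2 * z) (sh _ 1 ((cop_two hodd).mul_left hw)) ?_ (shz _ _ _ ?_) (by omega) (by omega) (by omega) (by omega)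
    · obtain ⟨t, ht⟩ := hx
      exact ⟨2 * t + 1, by linear_combination 2 * ht⟩
    · obtain ⟨t, ht⟩ := hz
      exact ⟨2 * t, by linear_combination 2 * ht⟩
  obtain ⟨x0, x1, hx⟩ := emod_rg hm0 u
  generalize u % m = x at *
  have sx : ∀ k, m ∣ u + k * N - (x + k * N) := fun k => by
    rwa [add_sub_add_right_eq_sub]
  by_cases g1 : 4 * x ≤ m + 2 * z
  · exact mid (u + 1 * N) (x + 1 * N) (sh _ _ hu) (sx 1) (shz _ _ _ hz) (by omega) (by omega)
  by_cases g2 : 3 * m + 2 * z ≤ 4 * x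
  · exact mid (u + (-1) * N) (x + (-1) * N) (sh _ _ hu) (sx (-1)) (shz _ _ _ hz) (by omega) (by omega)
  exact mid u x hu hx hz (by omega) (by omega)

lemma H3.nine' {m a : ℤ} (H : H3 m a) (h9 : (9 : ℤ) ∣ m) (ha : (3 : ℤ) ∣ a + 1) {D E A : ℤ} (hDE : m = D * E)
    (hA : a + 1 = D * A) (hAE : IsCoprime A E) (hD : 0 < D) (hE : 12 < E) : False := by
  have hm := H.hm
  have hm0 : 0 < m := by omega
  obtain ⟨p, q, hpq⟩ := hAE
  obtain ⟨u, hu, k, hk⟩ := unit_lift (x := p) (E := E) (m := m) (by omega) hm0 ⟨D, by linarith⟩ ⟨A, q, by linarith⟩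
  refine H.nine h9 ha hu (z := D) ⟨A * k - q, ?_⟩ hD.le (by nlinarith)
  rw [hA, hDE]
  linear_combination D * A * hk + D * hpq

lemma H3.nine_big {m a : ℤ} (H : H3 m a) (h9 : (9 : ℤ) ∣ m) (hbig : 432 < m) : False := by
  have hm0 : 0 < m := by omega
  have h3 : (3 : ℤ) ∣ a + 1 := by
    have h : (3 : ℤ) ∣ (a + 1) * (a - 2) := (by omega : (3 : ℤ) ∣ m).trans H.T
    rcases (Int.prime_three).dvd_or_dvd h with h | h <;> omega
  obtain ⟨D, E, A, hDE, hA, hc, hD, hE, _⟩ := H.decomp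
  by_cases hE12 : 12 < E
  · exact H.nine' h9 h3 hDE hA hc hD hE12
  obtain ⟨D', E', A', hDE', hA', hc', hD', hE', _⟩ := H.swap.decomp
  refine H.swap.nine' h9 (by omega) hDE' hA' hc' hD' ?_
  by_contra hE12'
  -- gcd(D, D') divides 3
  have hDD : D * D' ∣ 3 * m := by
    have e : 3 * m = (D * A + D' * A') * m := by rw [← hA, ← hA']; ring
    rw [e, add_mul]
    apply dvd_add
    · rw [hDE']; exact ⟨A * E', by ring⟩
    · rw [hDE]; exact ⟨A' * E, by ring⟩
  have := Int.le_of_dvd (by omega) hDD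
  have h1 : m ≤ 12 * D := by nlinarith
  have h2 : m ≤ 12 * D' := by nlinarith
  nlinarith

lemma H3.cop {m a D E j : ℤ} (H : H3 m a) (hDE : m = D * E) (hD1 : D ∣ a + 1) (hE2 : E ∣ a - 2) (hcop : IsCoprime D E)
    (hD : 21 ≤ D) (hE : 0 < E) (hj : IsCoprime j E) (j1 : E < 4 * j) (j2 : 42 * j < 17 * E) : False := by
  have hu : IsCoprime (j * D - E) m := by
    rw [hDE]
    apply IsCoprime.mul_right
    · exact cop_congr (x := -E) ⟨-j, by ring⟩ hcop.symm.neg_left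
    · exact cop_congr (x := j * D) ⟨1, by ring⟩ (hj.mul_left hcop)
  have b1 : 0 ≤ j * D - E := by nlinarith
  have b2 : 4 * E < D * (E - 2 * j) := by nlinarith
  have b3 : D * E < 2 * (2 * j * D + E) := by nlinarith
  refine H.V1 (j * D - E) (j * D - E) (2 * j * D + E) hu ⟨0, by ring⟩ ?_ b1 (by rw [hDE]; nlinarith) (by rw [hDE]; nlinarith) (by rw [hDE]; nlinarith) (by rw [hDE]; nlinarith)
  rw [hDE]
  apply hcop.mul_dvd
  · obtain ⟨t, ht⟩ := hD1
    exact ⟨j * a - E * t - 2 * j, by linear_combination -E * ht⟩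
  · obtain ⟨t, ht⟩ := hE2
    exact ⟨j * D * t - a - 1, by linear_combination j * D * ht⟩

lemma H3.not9 {m a : ℤ} (H : H3 m a) {D E : ℤ} (hDE : m = D * E) (hD1 : D ∣ a + 1) (hE2 : E ∣ a - 2) (hcop : IsCoprime D E)
    (h3 : ¬ (3 : ℤ) ∣ E) (hD : 21 ≤ D) (hE : 1 < E) : False := by
  have hodd := H.hodd
  have hE1 : E % 2 = 1 := by
    rcases Int.emod_two_eq_zero_or_one E with h | h
    · obtain ⟨t, rfl⟩ := Int.dvd_of_emod_eq_zero h
      rw [hDE, mul_left_comm] at hodd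
      omega
    · exact h
  have c3 : IsCoprime (3 : ℤ) E := by
    rw [Prime.coprime_iff_not_dvd (by norm_num)]; exact h3
  have go := fun j hj j1 j2 => H.cop (j := j) hDE hD1 hE2 hcop hD (by omega) hj j1 j2
  by_cases h8 : E < 8
  · exact go 2 (cop_two hE1) (by omega) (by omega)
  obtain ⟨I, hI, hI'⟩ := pow_between (t := (E - 1) / 2) (by omega)
  by_cases h42 : 42 * 2 ^ I < 17 * E
  · exact go (2 ^ I) (cop_two_pow hE1 I) (by rw [pow_succ] at hI'; omega) h42
  match I, hI, hI', h42 with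
  | 0, hI, hI', h42 => simp at hI'; omega
  | 1, hI, hI', h42 => simp at h42; omega
  | J + 2, hI, hI', h42 =>
    have e2 : (2 : ℤ) ^ (J + 2) = 4 * 2 ^ J := by ring
    have e3 : (2 : ℤ) ^ (J + 2 + 1) = 8 * 2 ^ J := by ring
    rw [e2] at hI h42
    rw [e3] at hI'
    exact go (3 * 2 ^ J) (c3.mul_left (cop_two_pow hE1 J)) (by omega) (by omega)

lemma H3.not9_one {m a : ℤ} (H : H3 m a) (h : m ∣ a + 1) : False := by
  have hm := H.hm
  have hodd := H.hodd
  obtain ⟨I, hI, hI'⟩ := pow_between (t := (m - 1) / 2) (by omega)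
  rw [pow_succ] at hI'
  obtain ⟨k, hk⟩ := h
  refine H.V1 (2 ^ I) (2 ^ I) (m - 2 ^ I) (cop_two_pow hodd I) ⟨0, by ring⟩ ⟨2 ^ I * k - 1, by linear_combination 2 ^ I * hk⟩ (by positivity) ?_ ?_ ?_ ?_ <;> omega

lemma H3.not9_dec {m a : ℤ} (H : H3 m a) (h9 : ¬ (9 : ℤ) ∣ m) : ∃ D E, m = D * E ∧ D ∣ a + 1 ∧ E ∣ a - 2 ∧ IsCoprime D E ∧
    ¬ (3 : ℤ) ∣ E ∧ 0 < D ∧ 0 < E := by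
  obtain ⟨D, E, A, hDE, hA, hc, hD, hE, hE2⟩ := H.decomp
  have hcop : IsCoprime D E := by
    apply cop_of_primes hE.ne'
    intro p hp hpE hpD
    have h1 : (p : ℤ) ∣ a + 1 := by rw [hA]; exact hpD.mul_right _
    have h2 := hpE.trans hE2
    have h3 : (p : ℤ) ∣ 3 := by have := dvd_sub h1 h2; ring_nf at this; exact this
    have h3' : p ∣ 3 := by exact_mod_cast h3
    have : p = 3 := ((Nat.dvd_prime (by norm_num)).1 h3').resolve_left hp.one_lt.ne'
    subst this
    apply h9
    rw [hDE]
    exact mul_dvd_mul hpD hpE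
  refine ⟨D, E, hDE, ⟨A, hA⟩, hE2, hcop, ?_, hD, hE⟩
  intro h3
  have h4 : (3 : ℤ) ∣ D * A := by
    have := h3.trans hE2
    rw [← hA]; omega
  rcases (Int.prime_three).dvd_or_dvd h4 with h | h
  · exact cop_not_dvd hcop h3 (by norm_num) h
  · exact cop_not_dvd hc h3 (by norm_num) h

lemma H3.contra {m a : ℤ} (H : H3 m a) : False := by
  by_cases hbig : m ≤ 432
  · exact H.small hbig
  push Not at hbig
  by_cases h9 : (9 : ℤ) ∣ m
  · exact H.nine_big h9 hbig
  obtain ⟨D, E, hDE, hD1, hE2, hcop, h3, hD, hE⟩ := H.not9_dec h9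
  by_cases hE1 : E = 1
  · subst hE1
    exact H.not9_one (by rw [hDE, mul_one]; exact hD1)
  by_cases hD21 : 21 ≤ D
  · exact H.not9 hDE hD1 hE2 hcop h3 hD21 (by omega)
  obtain ⟨D', E', hDE', hD1', hE2', hcop', h3', hD', hE'⟩ := H.swap.not9_dec h9
  by_cases hE1' : E' = 1
  · subst hE1'
    exact H.swap.not9_one (by rw [hDE', mul_one]; exact hD1')
  refine H.swap.not9 hDE' hD1' hE2' hcop' h3' ?_ (by omega)
  have hEE : IsCoprime E E' := by
    apply cop_of_primes hE'.ne'
    intro p hp hpE' hpE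
    have h1 := hpE'.trans hE2'
    have h2 := hpE.trans hE2
    have h4 : (p : ℤ) ∣ 3 := by
      obtain ⟨s, hs⟩ := h1
      obtain ⟨t, ht⟩ := h2
      exact ⟨-s - t, by linear_combination -hs - ht⟩
    have h5 : p ∣ 3 := by exact_mod_cast h4
    have : p = 3 := ((Nat.dvd_prime (by norm_num)).1 h5).resolve_left hp.one_lt.ne'
    subst this
    exact h3 hpE
  have h6 : E ∣ D' := hEE.dvd_of_dvd_mul_right (hDE' ▸ Dvd.intro_left D hDE.symm)
  have h7 := Int.le_of_dvd hD' h6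
  have h8 : 21 ≤ E := by
    by_contra h; push Not at h; nlinarith
  omega

lemma caseII_core {n a b c : ℤ} (H : Hyp n a b c) (h4 : n % 4 = 2) (hbig : 160 < n)
    (ha : a % 2 = 1) (hb : b % 2 = 1) (hc : c % 2 = 0) : a = 1 ∧ b = 1 := by
  obtain ⟨m, rfl⟩ : ∃ m, n = 2 * m := ⟨n / 2, by omega⟩
  have hm : 80 < m := by omega
  have hm0 : 0 < m := by omega
  have h2 := H2_of H hm (by omega) ha hb hc
  have p1 := H.ha
  have p2 := H.hb
  have p3 := H.hc
  have hs := H.hsum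
  obtain ⟨d0, d1, hd⟩ := emod_rg hm0 (a + b - 1)
  rcases d0.eq_or_lt with h | h
  · rw [← h, sub_zero] at hd
    exact (h2.toH3 hd).contra.elim
  · have h1 := h2.d_one hd h d1
    rw [h1] at hd
    have h5 : m ∣ c + 2 := by
      obtain ⟨k, hk⟩ := hd
      exact ⟨2 - k, by linear_combination hs - hk⟩
    obtain ⟨k, hk⟩ := h5
    have k1 : 0 < k := by by_contra h; push Not at h; nlinarith
    have k2 : k < 3 := by by_contra h; push Not at h; nlinarith
    have k3 : k = 1 ∨ k = 2 := by omega
    rcases k3 with rfl | rfl <;> omega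

lemma caseII {n a b c : ℤ} (H : Hyp n a b c) (h4 : n % 4 = 2) (hbig : 160 < n) : Concl n a b c := by
  rcases H.parity (by omega) with ⟨h1, h2, h3⟩ | ⟨h1, h2, h3⟩ | ⟨h1, h2, h3⟩
  · have := caseII_core H h4 hbig h1 h2 h3
    unfold Concl; tauto
  · have := caseII_core H.rot h4 hbig h1 h2 h3
    unfold Concl; tauto
  · have := caseII_core H.rot.rot h4 hbig h1 h2 h3
    unfold Concl; tauto


def PQ (x a b c : ℤ) : Prop := (a = x ∧ b = x) ∨ (b = x ∧ c = x) ∨ (c = x ∧ a = x)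

def P18 (a b c : ℤ) : Prop :=
  (a = 1 ∧ b = 4 ∧ c = 13) ∨ (a = 1 ∧ b = 13 ∧ c = 4) ∨ (a = 4 ∧ b = 1 ∧ c = 13) ∨ (a = 4 ∧ b = 13 ∧ c = 1) ∨
  (a = 13 ∧ b = 1 ∧ c = 4) ∨ (a = 13 ∧ b = 4 ∧ c = 1)

def PP (n a b c : ℤ) : Prop :=
  PQ 1 a b c ∨ (n % 4 = 0 ∧ PQ ((n - 2) / 2) a b c) ∨ (n = 12 ∧ PQ 3 a b c) ∨ (n = 18 ∧ P18 a b c) ∨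
  (n = 24 ∧ PQ 5 a b c) ∨ (n = 24 ∧ PQ 7 a b c) ∨ (n = 60 ∧ PQ 11 a b c) ∨ (n = 60 ∧ PQ 19 a b c)

lemma PQ.swap {x a b c : ℤ} (h : PQ x a b c) : PQ x b a c := by unfold PQ at *; tauto
lemma PQ.rot {x a b c : ℤ} (h : PQ x a b c) : PQ x b c a := by unfold PQ at *; tauto
lemma P18.swap {a b c : ℤ} (h : P18 a b c) : P18 b a c := by 
  unfold P18 at *
  rcases h with ⟨rfl, rfl, rfl⟩ | ⟨rfl, rfl, rfl⟩ | ⟨rfl, rfl, rfl⟩ | ⟨rfl, rfl, rfl⟩ | ⟨rfl, rfl, rfl⟩ | ⟨rfl, rfl, rfl⟩ <;> simp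
lemma P18.rot {a b c : ℤ} (h : P18 a b c) : P18 b c a := by 
  unfold P18 at *
  rcases h with ⟨rfl, rfl, rfl⟩ | ⟨rfl, rfl, rfl⟩ | ⟨rfl, rfl, rfl⟩ | ⟨rfl, rfl, rfl⟩ | ⟨rfl, rfl, rfl⟩ | ⟨rfl, rfl, rfl⟩ <;> simp

lemma PP.swap {n a b c : ℤ} (h : PP n a b c) : PP n b a c := by
  unfold PP at *
  exact h.imp PQ.swap (Or.imp (And.imp_right PQ.swap) (Or.imp (And.imp_right PQ.swap) (Or.imp (And.imp_right P18.swap)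
    (Or.imp (And.imp_right PQ.swap) (Or.imp (And.imp_right PQ.swap) (Or.imp (And.imp_right PQ.swap) (And.imp_right PQ.swap)))))))

lemma PP.rot {n a b c : ℤ} (h : PP n a b c) : PP n b c a := by
  unfold PP at *
  exact h.imp PQ.rot (Or.imp (And.imp_right PQ.rot) (Or.imp (And.imp_right PQ.rot) (Or.imp (And.imp_right P18.rot)
    (Or.imp (And.imp_right PQ.rot) (Or.imp (And.imp_right PQ.rot) (Or.imp (And.imp_right PQ.rot) (And.imp_right PQ.rot)))))))

lemma PP_of_small {n a b c : ℤ} (H : Hyp n a b c) (hab : a ≤ b) (hbc : b ≤ c) (h4 : 4 ≤ n) (hn : n ≤ 160)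
    (h2 : n % 2 = 0) : PP n a b c := by
  have h := small_case H hab hbc h4 hn h2
  have hs := H.hsum
  unfold SmallC at h
  unfold PP PQ P18
  rcases h with h | ⟨e, h, h'⟩ | ⟨e, h⟩ | ⟨e, h, h'⟩ | ⟨e, h⟩ | ⟨e, h⟩ | ⟨e, h⟩ | ⟨e, h⟩
  · exact Or.inl (Or.inl h)
  · exact Or.inr (Or.inl ⟨e, Or.inr (Or.inl (by omega))⟩)
  · exact Or.inr (Or.inr (Or.inl ⟨e, Or.inl h⟩))
  · exact Or.inr (Or.inr (Or.inr (Or.inl ⟨e, Or.inl (by omega)⟩)))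
  · exact Or.inr (Or.inr (Or.inr (Or.inr (Or.inl ⟨e, Or.inl h⟩))))
  · exact Or.inr (Or.inr (Or.inr (Or.inr (Or.inr (Or.inl ⟨e, Or.inl h⟩)))))
  · exact Or.inr (Or.inr (Or.inr (Or.inr (Or.inr (Or.inr (Or.inl ⟨e, Or.inl h⟩))))))
  · exact Or.inr (Or.inr (Or.inr (Or.inr (Or.inr (Or.inr (Or.inr ⟨e, Or.inl h⟩))))))

lemma PP_of_concl {n a b c : ℤ} (h : Concl n a b c) : PP n a b c := by
  unfold Concl at h
  unfold PP PQ
  rcases h with h | h | h | ⟨e, h⟩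
  · exact Or.inl (Or.inl h)
  · exact Or.inl (Or.inr (Or.inl h))
  · exact Or.inl (Or.inr (Or.inr h))
  · exact Or.inr (Or.inl ⟨e, by omega⟩)

lemma PQ.mem {n : ℕ} {x a b c : ℤ} (h : PQ x a b c) (hc : c = n - a - b) : (a, b) ∈ orbJ n (x, x) := by
  unfold PQ at h
  simp only [orbJ, Jv, Finset.mem_insert, Finset.mem_singleton, Prod.mk.injEq]
  rcases h with h | h | h
  · exact Or.inl h
  · exact Or.inr (Or.inl (by omega))
  · exact Or.inr (Or.inr (by omega))

lemma P18.mem {a b c : ℤ} (h : P18 a b c) : (a, b) ∈ orbCJ 18 (4, 1) := by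
  unfold P18 at h
  rcases h with ⟨rfl, rfl, _⟩ | ⟨rfl, rfl, _⟩ | ⟨rfl, rfl, _⟩ | ⟨rfl, rfl, _⟩ | ⟨rfl, rfl, _⟩ | ⟨rfl, rfl, _⟩ <;>
    simp [orbCJ, orbJ, Jv, Cv]

theorem statement9 (n : ℕ) (hn : 4 ≤ n) (lam : ℤ × ℤ) (hmem : lam ∈ Phi3 n)
    (hT : (n : ℤ) ∣ (lam.1 ^ 2 + lam.1 * lam.2 + lam.2 ^ 2 - 3))
    (hGal : ∀ ℓ : ℤ, Int.gcd ℓ (3 * n) = 1 →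
      ((ℓ * lam.1) % (n : ℤ) + (ℓ * lam.2) % (n : ℤ) < (n : ℤ) ↔ 2 * (ℓ % (n : ℤ)) < (n : ℤ))) :
    (¬ (4 ∣ n) ∧ n ≠ 18 → lam ∈ orbJ n (1, 1)) ∧
    (4 ∣ n ∧ n ≠ 12 ∧ n ≠ 24 ∧ n ≠ 60 →
      lam ∈ orbJ n (1, 1) ∪ orbJ n (((n : ℤ) - 2) / 2, ((n : ℤ) - 2) / 2)) ∧
    (n = 12 → lam ∈ orbJ n (1, 1) ∪ orbJ n (3, 3) ∪ orbJ n (5, 5)) ∧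
    (n = 18 → lam ∈ orbJ n (1, 1) ∪ orbCJ n (4, 1)) ∧
    (n = 24 → lam ∈ orbJ n (1, 1) ∪ orbJ n (5, 5) ∪ orbJ n (7, 7) ∪ orbJ n (11, 11)) ∧
    (n = 60 → lam ∈ orbJ n (1, 1) ∪ orbJ n (11, 11) ∪ orbJ n (19, 19) ∪ orbJ n (29, 29)) := by
  obtain ⟨a, b⟩ := lam
  simp only [Phi3, Finset.mem_filter, Finset.mem_Icc, Prod.mk_le_mk] at hmem hT hGal
  obtain ⟨⟨⟨ha, hb⟩, _⟩, hab⟩ := hmem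
  have H := mk_hyp n a b (by omega) (by omega) (by omega) hT hGal
  obtain ⟨c, hc⟩ : ∃ c : ℤ, c = n - a - b := ⟨_, rfl⟩
  rw [← hc] at H
  have key : PP n a b c := by
    by_cases hodd : (n : ℤ) % 2 = 1
    · exact PP_of_concl (caseI H hodd (by omega))
    by_cases hs : 160 < (n : ℤ)
    · by_cases h4 : (n : ℤ) % 4 = 0
      · exact PP_of_concl (caseIII H h4 hs)
      · exact PP_of_concl (caseII H (by omega) hs)
    · have go : ∀ x y z : ℤ, Hyp n x y z → x ≤ y → y ≤ z → PP n x y z := fun x y z h h1 h2 =>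
        PP_of_small h h1 h2 (by omega) (by omega) (by omega)
      rcases le_total a b with h1 | h1 <;> rcases le_total b c with h2 | h2 <;> rcases le_total a c with h3 | h3
      · exact go _ _ _ H h1 h2
      · exact go _ _ _ H h1 h2
      · exact (go _ _ _ H.rot.rot.swap h3 h2).swap.rot
      · exact (go _ _ _ H.rot.rot h3 h1).rot
      · exact (go _ _ _ H.swap h1 h3).swap
      · exact (go _ _ _ H.rot h2 h3).rot.rot
      · exact (go _ _ _ H.rot.swap h2 h1).swap.rot.rot
      · exact (go _ _ _ H.rot.swap h2 h1).swap.rot.rot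
  clear H hT hGal
  simp only [Finset.mem_union]
  unfold PP at key
  rcases key with h | ⟨e, h⟩ | ⟨e, h⟩ | ⟨e, h⟩ | ⟨e, h⟩ | ⟨e, h⟩ | ⟨e, h⟩ | ⟨e, h⟩
  · have := h.mem hc
    tauto
  · have hM := h.mem hc
    have d4 : 4 ∣ n := by omega
    refine ⟨fun g => absurd d4 g.1, fun _ => Or.inr hM, fun g => ?_, fun g => by omega, fun g => ?_, fun g => ?_⟩ <;>
    · subst g
      exact Or.inr hM
  · have hM := h.mem hc
    refine ⟨fun g => by omega, fun g => by omega, fun g => Or.inl (Or.inr hM), fun g => by omega, fun g => by omega, fun g => by omega⟩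
  · have hM := h.mem
    refine ⟨fun g => by omega, fun g => by omega, fun g => by omega, fun g => Or.inr (g ▸ hM), fun g => by omega, fun g => by omega⟩
  · have hM := h.mem hc
    refine ⟨fun g => by omega, fun g => by omega, fun g => by omega, fun g => by omega, fun g => Or.inl (Or.inl (Or.inr hM)), fun g => by omega⟩
  · have hM := h.mem hc
    refine ⟨fun g => by omega, fun g => by omega, fun g => by omega, fun g => by omega, fun g => Or.inl (Or.inr hM), fun g => by omega⟩
  · have hM := h.mem hc
    refine ⟨fun g => by omega, fun g => by omega, fun g => by omega, fun g => by omega, fun g => by omega, fun g => Or.inl (Or.inl (Or.inr hM))⟩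
  · have hM := h.mem hc
    refine ⟨fun g => by omega, fun g => by omega, fun g => by omega, fun g => by omega, fun g => by omega, fun g => Or.inl (Or.inr hM)⟩
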